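/- For every integer d ≥ 3 and every regular d-simplex centered at the origin of ℝ^d, the cone C_σ(d) over the (d−2)-skeleton of the simplex is an Almgren minimal set of dimension d−1 in ℝ^d. (Derived in the paper from Theorem 3.5 2° and Example 5.4.) -/

import Mathlib

open Set MeasureTheory Metric NNReal

noncomputable section

/-- A deformation in an open set `U ⊆ ℝ^N`. -/
def IsDeformation {N : ℕ} (U : Set (EuclideanSpace ℝ (Fin N)))
    (φ : ℝ → EuclideanSpace ℝ (Fin N) → EuclideanSpace ℝ (Fin N)) : Prop :=
  (∀ t ∈ Icc (0:ℝ) 1, MapsTo (φ t) (closure U) (closure U)) ∧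
  (∀ x ∈ closure U, φ 0 x = x) ∧
  ContinuousOn (fun p : ℝ × EuclideanSpace ℝ (Fin N) => φ p.1 p.2)
    (Icc (0:ℝ) 1 ×ˢ closure U) ∧
  (∃ K : ℝ≥0, LipschitzOnWith K (φ 1) (closure U)) ∧
  (closure (⋃ t ∈ Icc (0:ℝ) 1,
      ({x ∈ closure U | φ t x ≠ x} ∪ φ t '' {x ∈ closure U | φ t x ≠ x})) ⊆ U ∧
    IsCompact (closure (⋃ t ∈ Icc (0:ℝ) 1,
      ({x ∈ closure U | φ t x ≠ x} ∪ φ t '' {x ∈ closure U | φ t x ≠ x}))))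

/-- `E` is an Almgren minimal set of dimension `d` in the open set `U`. -/
def AlmgrenMinimal {N : ℕ} (d : ℝ) (U E : Set (EuclideanSpace ℝ (Fin N))) : Prop :=
  IsClosed E ∧ E ⊆ closure U ∧
  (∀ (x : EuclideanSpace ℝ (Fin N)) (r : ℝ), closedBall x r ⊆ U →
      μH[d] (E ∩ closedBall x r) < ⊤) ∧
  ∀ φ, IsDeformation U φ →
    μH[d] (E \ (φ 1 '' E)) ≤ μH[d] ((φ 1 '' E) \ E)

/-- Sum of squares of the coordinates with index in `[a, b)`. -/
def sumSq {n : ℕ} (z : EuclideanSpace ℝ (Fin n)) (a b : ℕ) : ℝ :=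
  ∑ i : Fin n, if a ≤ (i : ℕ) ∧ (i : ℕ) < b then z i ^ 2 else 0

end

noncomputable section

/-- The cone over a set `X ⊆ ℝ^d`: all nonnegative multiples of points of `X`. -/
def coneOver {d : ℕ} (X : Set (EuclideanSpace ℝ (Fin d))) : Set (EuclideanSpace ℝ (Fin d)) :=
  {y | ∃ t : ℝ, 0 ≤ t ∧ ∃ x ∈ X, y = t • x}

/-- The (d−2)-skeleton of the cube [−1,1]^d: points of the cube with at least two
coordinates of absolute value 1. -/
def cubeSkeleton (d : ℕ) : Set (EuclideanSpace ℝ (Fin d)) :=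
  {x | (∀ i, |x i| ≤ 1) ∧ ∃ i j : Fin d, i ≠ j ∧ |x i| = 1 ∧ |x j| = 1}

/-- The (d−2)-skeleton of the simplex with vertices `v 0, …, v d`: the union of the convex
hulls of all sets of `d−1` of the vertices. -/
def simplexSkeleton (d : ℕ) (v : Fin (d+1) → EuclideanSpace ℝ (Fin d)) :
    Set (EuclideanSpace ℝ (Fin d)) :=
  ⋃ A ∈ {A : Finset (Fin (d+1)) | A.card = d - 1}, convexHull ℝ (v '' ↑A)

end

noncomputable section

open scoped RealInnerProductSpace ENNReal

/-- Coordinate Euclidean space. -/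
abbrev Euc (n : ℕ) : Type := EuclideanSpace ℝ (Fin n)

open scoped RealInnerProductSpace ENNReal

theorem LipschitzOnWith.euclideanHausdorffMeasure_image_le {X Y : Type*}
    [MetricSpace X] [MeasurableSpace X] [BorelSpace X]
    [MetricSpace Y] [MeasurableSpace Y] [BorelSpace Y] {K : ℝ≥0} {f : X → Y} {s : Set X}
    (h : LipschitzOnWith K f s) (d : ℕ) :
    μHE[d] (f '' s) ≤ (K : ℝ≥0∞) ^ d * μHE[d] s := by
  have := h.hausdorffMeasure_image_le (d := d) (by positivity)
  rw [Measure.euclideanHausdorffMeasure_def, Measure.euclideanHausdorffMeasure_def,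
    Measure.smul_apply, Measure.smul_apply, ENNReal.smul_def, ENNReal.smul_def, smul_eq_mul,
    smul_eq_mul, mul_left_comm]
  gcongr
  simpa using this

/-- The rank one perturbation `y ↦ y + a ⟪b, y⟫ b` of the identity. -/
def rankOneMap {m : ℕ} (a : ℝ) (b : Euc m) : Euc m →ₗ[ℝ] Euc m :=
  LinearMap.transvection (a • (innerₛₗ ℝ b)) b

theorem rankOneMap_apply {m : ℕ} (a : ℝ) (b y : Euc m) :
    rankOneMap a b y = y + (a * ⟪b, y⟫) • b := by
  simp [rankOneMap, LinearMap.transvection]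

theorem volume_rankOneMap_image {m : ℕ} (a : ℝ) (b : Euc m) (s : Set (Euc m)) :
    volume (rankOneMap a b '' s) = ENNReal.ofReal |1 + a * ‖b‖ ^ 2| * volume s := by
  rw [Measure.addHaar_image_linearMap, rankOneMap, LinearMap.transvection.det]
  simp

/-- The point at height `t` above `z` in the orthonormal frame given by `T`. -/
def framePoint {m : ℕ} (T : Euc (m + 1) ≃ₗᵢ[ℝ] Euc (m + 1)) (z : Euc m) (t : ℝ) : Euc (m + 1) :=
  T (WithLp.toLp 2 (Fin.cons t z))

/-- The first vector of the frame `T`. -/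
def frameAxis {m : ℕ} (T : Euc (m + 1) ≃ₗᵢ[ℝ] Euc (m + 1)) : Euc (m + 1) :=
  T (EuclideanSpace.single 0 1)

/-- The orthogonal projection along the axis of the frame `T`. -/
def frameProj {m : ℕ} (T : Euc (m + 1) ≃ₗᵢ[ℝ] Euc (m + 1)) : Euc (m + 1) →ₗ[ℝ] Euc m where
  toFun x := WithLp.toLp 2 (fun i => T.symm x i.succ)
  map_add' x y := by ext i; simp
  map_smul' x y := by ext i; simp

section frame

variable {m : ℕ} (T : Euc (m + 1) ≃ₗᵢ[ℝ] Euc (m + 1))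

theorem frameProj_apply (x : Euc (m + 1)) (i : Fin m) : frameProj T x i = T.symm x i.succ := rfl

theorem inner_frameAxis (x : Euc (m + 1)) : ⟪frameAxis T, x⟫ = T.symm x 0 := by
  have h := T.inner_map_map (EuclideanSpace.single 0 1) (T.symm x)
  rw [T.apply_symm_apply] at h
  simp [frameAxis, h, EuclideanSpace.inner_single_left]

@[simp] theorem frameProj_framePoint (z : Euc m) (t : ℝ) : frameProj T (framePoint T z t) = z := by
  ext i; simp [frameProj_apply, framePoint]

@[simp] theorem inner_frameAxis_framePoint (z : Euc m) (t : ℝ) :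
    ⟪frameAxis T, framePoint T z t⟫ = t := by
  simp [inner_frameAxis, framePoint]

theorem framePoint_frameProj (x : Euc (m + 1)) :
    framePoint T (frameProj T x) ⟪frameAxis T, x⟫ = x := by
  rw [framePoint, inner_frameAxis]
  have : WithLp.toLp 2 (Fin.cons (T.symm x 0) (frameProj T x) : Fin (m + 1) → ℝ) = T.symm x := by
    ext i
    refine Fin.cases ?_ (fun j => ?_) i
    · simp
    · simp [frameProj_apply]
  rw [this, T.apply_symm_apply]

theorem framePoint_eq_add (z : Euc m) (t : ℝ) :
    framePoint T z t = framePoint T z 0 + t • frameAxis T := by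
  rw [framePoint, framePoint, frameAxis, ← map_smul, ← map_add]
  congr 1
  ext i
  refine Fin.cases ?_ (fun j => ?_) i <;> simp

theorem inner_eq_frame (x y : Euc (m + 1)) :
    ⟪x, y⟫ = ⟪frameProj T x, frameProj T y⟫ + ⟪frameAxis T, x⟫ * ⟪frameAxis T, y⟫ := by
  rw [← T.symm.inner_map_map x y, inner_frameAxis, inner_frameAxis]
  simp only [PiLp.inner_apply, Fin.sum_univ_succ, frameProj_apply]
  simp
  ring

theorem norm_sq_eq_frame (x : Euc (m + 1)) :
    ‖x‖ ^ 2 = ‖frameProj T x‖ ^ 2 + ⟪frameAxis T, x⟫ ^ 2 := by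
  rw [← real_inner_self_eq_norm_sq, inner_eq_frame T, real_inner_self_eq_norm_sq]; ring

@[simp] theorem norm_frameAxis : ‖frameAxis T‖ = 1 := by
  simp [frameAxis]

theorem norm_frameProj_le (x : Euc (m + 1)) : ‖frameProj T x‖ ≤ ‖x‖ := by
  have := norm_sq_eq_frame T x
  exact le_of_sq_le_sq (by nlinarith [sq_nonneg ⟪frameAxis T, x⟫]) (norm_nonneg _)

theorem lipschitzWith_frameProj : LipschitzWith 1 (frameProj T) := by
  refine LipschitzWith.of_dist_le_mul fun x y => ?_
  rw [dist_eq_norm, dist_eq_norm, ← map_sub]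
  simpa using norm_frameProj_le T (x - y)

theorem volume_frameProj_image_le (s : Set (Euc (m + 1))) :
    volume (frameProj T '' s) ≤ μHE[m] s := by
  have := (lipschitzWith_frameProj T).lipschitzOnWith (s := s)
    |>.euclideanHausdorffMeasure_image_le m
  rw [EuclideanSpace.euclideanHausdorffMeasure_eq_volume] at this
  simpa using this

theorem continuous_framePoint : Continuous fun p : Euc m × ℝ => framePoint T p.1 p.2 := by
  have h : Continuous fun z : Euc m => framePoint T z 0 := by
    unfold framePoint
    refine T.continuous.comp ((PiLp.continuous_toLp 2 _).comp ?_)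
    refine continuous_pi fun i => ?_
    refine Fin.cases ?_ (fun j => ?_) i
    · simpa using continuous_const
    · simp only [Fin.cons_succ]; fun_prop
  have : (fun p : Euc m × ℝ => framePoint T p.1 p.2)
      = fun p => framePoint T p.1 0 + p.2 • frameAxis T := by
    ext1 p; exact framePoint_eq_add T p.1 p.2
  rw [this]
  exact (h.comp continuous_fst).add (continuous_snd.smul continuous_const)

theorem measurePreserving_framePoint :
    MeasurePreserving (fun p : Euc m × ℝ => framePoint T p.1 p.2)
      ((volume : Measure (Euc m)).prod (volume : Measure ℝ)) volume := by
  have h1 : MeasurePreserving (Prod.swap : Euc m × ℝ → ℝ × Euc m)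
      ((volume : Measure (Euc m)).prod (volume : Measure ℝ)) (volume.prod volume) :=
    Measure.measurePreserving_swap
  have h2 : MeasurePreserving (Prod.map id (WithLp.ofLp) : ℝ × Euc m → ℝ × (Fin m → ℝ))
      (volume.prod volume) (volume.prod volume) :=
    (MeasurePreserving.id _).prod (EuclideanSpace.volume_preserving_symm_measurableEquiv_toLp _)
  have h3 := (volume_preserving_piFinSuccAbove (fun _ : Fin (m + 1) => ℝ) 0).symm
  have h4 := EuclideanSpace.volume_preserving_symm_measurableEquiv_toLp (Fin (m + 1)) |>.symm
  have h5 := T.measurePreserving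
  have := h5.comp (h4.comp (h3.comp (h2.comp h1)))
  have e : (fun p : Euc m × ℝ => framePoint T p.1 p.2) =
      T ∘ (MeasurableEquiv.toLp 2 (Fin (m + 1) → ℝ)).symm.symm ∘
        (MeasurableEquiv.piFinSuccAbove (fun _ => ℝ) 0).symm ∘
          Prod.map id WithLp.ofLp ∘ Prod.swap := by
    funext p
    simp [framePoint]
    rfl
  rw [e]
  exact this

theorem exists_frame_of_norm_eq_one {e : Euc (m + 1)} (he : ‖e‖ = 1) :
    ∃ T : Euc (m + 1) ≃ₗᵢ[ℝ] Euc (m + 1), frameAxis T = e := by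
  have ho : Orthonormal ℝ (fun i : ({0} : Set (Fin (m + 1))) => e) := by
    rw [orthonormal_iff_ite]
    rintro ⟨i, hi⟩ ⟨j, hj⟩
    simp only [mem_singleton_iff] at hi hj
    subst hi; subst hj
    simp [he]
  obtain ⟨b, hb⟩ := Orthonormal.exists_orthonormalBasis_extension_of_card_eq
    (𝕜 := ℝ) (E := Euc (m + 1)) (ι := Fin (m + 1)) (by simp) (v := fun _ => e) (s := {0}) ho
  refine ⟨b.repr.symm, ?_⟩
  rw [frameAxis]
  simpa using hb 0 rfl

end frame

end

noncomputable section

open scoped RealInnerProductSpace ENNReal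

theorem euclideanHausdorffMeasure_image_le_of_dist_le {α X Y : Type*}
    [MetricSpace X] [MeasurableSpace X] [BorelSpace X]
    [MetricSpace Y] [MeasurableSpace Y] [BorelSpace Y] {K : ℝ≥0} {f : α → X} {g : α → Y} {s : Set α}
    (h : ∀ x ∈ s, ∀ y ∈ s, dist (f x) (f y) ≤ K * dist (g x) (g y)) (d : ℕ) :
    μHE[d] (f '' s) ≤ (K : ℝ≥0∞) ^ d * μHE[d] (g '' s) := by
  rcases s.eq_empty_or_nonempty with rfl | ⟨x₀, -⟩
  · simp
  have : Nonempty α := ⟨x₀⟩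
  set k := Function.invFunOn g s
  have hk : ∀ x ∈ s, k (g x) ∈ s ∧ g (k (g x)) = g x := fun x hx =>
    ⟨Function.invFunOn_mem ⟨x, hx, rfl⟩, Function.invFunOn_eq ⟨x, hx, rfl⟩⟩
  have hf : ∀ x ∈ s, f (k (g x)) = f x := fun x hx => by
    have := h _ (hk x hx).1 x hx
    rw [(hk x hx).2, dist_self, mul_zero] at this
    exact dist_le_zero.1 this
  have hL : LipschitzOnWith K (f ∘ k) (g '' s) := by
    refine LipschitzOnWith.of_dist_le_mul ?_
    rintro _ ⟨x, hx, rfl⟩ _ ⟨y, hy, rfl⟩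
    simpa [hf x hx, hf y hy] using h x hx y hy
  have himg : f '' s = (f ∘ k) '' (g '' s) := by
    rw [image_image]
    exact image_congr fun x hx => (hf x hx).symm
  rw [himg]
  exact hL.euclideanHausdorffMeasure_image_le d

theorem norm_rankOneMap_sq {m : ℕ} (a : ℝ) (b y : Euc m) :
    ‖rankOneMap a b y‖ ^ 2 = ‖y‖ ^ 2 + (2 * a + a ^ 2 * ‖b‖ ^ 2) * ⟪b, y⟫ ^ 2 := by
  rw [rankOneMap_apply, norm_add_sq_real, inner_smul_right, norm_smul, mul_pow,
    Real.norm_eq_abs, sq_abs, real_inner_comm b y]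
  ring

/-- Projecting a set that is almost orthogonal to `n` along a direction orthogonal to `n`
decreases its measure a lot. -/
theorem volume_frameProj_image_le_of_flat {m : ℕ} (T : Euc (m + 1) ≃ₗᵢ[ℝ] Euc (m + 1))
    {n : Euc (m + 1)} (hn : ‖n‖ = 1) (hT : ⟪frameAxis T, n⟫ = 0) {ε : ℝ} (hε : 0 < ε)
    {s : Set (Euc (m + 1))} (hs : ∀ x ∈ s, ∀ y ∈ s, |⟪n, x - y⟫| ≤ ε * ‖x - y‖) :
    volume (frameProj T '' s) ≤ ENNReal.ofReal ε * 2 ^ m * μHE[m] s := by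
  set u := frameProj T n
  have hu : ‖u‖ = 1 := by
    have := norm_sq_eq_frame T n
    rw [hn, hT] at this
    have h2 : ‖u‖ ^ 2 = 1 := by linarith
    nlinarith [norm_nonneg u]
  have hin : ∀ x, ⟪u, frameProj T x⟫ = ⟪n, x⟫ := fun x => by
    rw [inner_eq_frame T n x, hT]; simp [u]
  have key := euclideanHausdorffMeasure_image_le_of_dist_le (K := 2) (s := s)
    (f := fun x => rankOneMap (1 / ε - 1) u (frameProj T x)) (g := fun x => x) (by
      intro x hx y hy
      rw [dist_eq_norm, dist_eq_norm, ← map_sub, ← map_sub]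
      refine abs_le_of_sq_le_sq' ?_ (by positivity) |>.2
      rw [norm_rankOneMap_sq, hu, hin]
      have h1 := norm_frameProj_le T (x - y)
      have h2 := hs x hx y hy
      have h3 : ‖frameProj T (x - y)‖ ^ 2 ≤ ‖x - y‖ ^ 2 := by gcongr
      have h4 : ⟪n, x - y⟫ ^ 2 ≤ ε ^ 2 * ‖x - y‖ ^ 2 := by
        rw [← sq_abs, ← mul_pow]; gcongr
      have h5 : (2 * (1 / ε - 1) + (1 / ε - 1) ^ 2 * 1 ^ 2) * ⟪n, x - y⟫ ^ 2 ≤ ‖x - y‖ ^ 2 := by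
        have e : 2 * (1 / ε - 1) + (1 / ε - 1) ^ 2 * 1 ^ 2 = 1 / ε ^ 2 - 1 := by field_simp; ring
        rw [e]
        have : 1 / ε ^ 2 * ⟪n, x - y⟫ ^ 2 ≤ ‖x - y‖ ^ 2 := by
          rw [one_div, inv_mul_le_iff₀ (by positivity)]; exact h4
        nlinarith [sq_nonneg ⟪n, x - y⟫]
      have : ((2 : ℝ≥0) : ℝ) = 2 := rfl
      rw [this, mul_pow]
      nlinarith [sq_nonneg ‖x - y‖]) m
  rw [← image_image (fun z => rankOneMap (1 / ε - 1) u z), image_id',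
    EuclideanSpace.euclideanHausdorffMeasure_eq_volume, volume_rankOneMap_image, hu] at key
  have e : |1 + (1 / ε - 1) * (1 : ℝ) ^ 2| = ε⁻¹ := by
    rw [one_pow, mul_one, add_sub_cancel, one_div, abs_of_pos (by positivity)]
  rw [e] at key
  calc volume (frameProj T '' s)
      = ENNReal.ofReal ε * (ENNReal.ofReal ε⁻¹ * volume (frameProj T '' s)) := by
        rw [← mul_assoc, ← ENNReal.ofReal_mul hε.le, mul_inv_cancel₀ hε.ne']; simp
    _ ≤ ENNReal.ofReal ε * (2 ^ m * μHE[m] s) := mul_le_mul' le_rfl (by simpa using key)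
    _ = _ := by ring

/-- The measure of a subset of a hyperplane is controlled by the measure of its projection. -/
theorem euclideanHausdorffMeasure_le_volume_frameProj_image {m : ℕ}
    (T : Euc (m + 1) ≃ₗᵢ[ℝ] Euc (m + 1))
    {n : Euc (m + 1)} (hn : ‖n‖ = 1) {q : ℝ} (hq : 0 < q) (hT : ⟪frameAxis T, n⟫ = q)
    {s : Set (Euc (m + 1))} (hs : ∀ x ∈ s, ⟪n, x⟫ = 0) :
    μHE[m] s ≤ ENNReal.ofReal q⁻¹ * volume (frameProj T '' s) := by
  set b := frameProj T n
  have hb : ‖b‖ ^ 2 = 1 - q ^ 2 := by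
    have := norm_sq_eq_frame T n
    rw [hn, hT] at this; linarith
  set a := 1 / (q * (1 + q))
  have h1q : 0 < 1 + q := by positivity
  have key := euclideanHausdorffMeasure_image_le_of_dist_le (K := 1) (s := s)
    (g := fun x => rankOneMap a b (frameProj T x)) (f := fun x => x) (by
      intro x hx y hy
      rw [dist_eq_norm, dist_eq_norm, ← map_sub, ← map_sub, NNReal.coe_one, one_mul]
      refine abs_le_of_sq_le_sq' ?_ (by positivity) |>.2
      rw [norm_rankOneMap_sq, norm_sq_eq_frame T (x - y)]
      have h0 : ⟪n, x - y⟫ = 0 := by rw [inner_sub_right, hs x hx, hs y hy, sub_zero]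
      rw [inner_eq_frame T, hT] at h0
      have h2 : ⟪b, frameProj T (x - y)⟫ = -(q * ⟪frameAxis T, x - y⟫) := by linarith
      rw [h2, hb]
      apply le_of_eq
      congr 1
      simp only [a]
      field_simp
      ring) m
  rw [← image_image (fun z => rankOneMap a b z), image_id',
    EuclideanSpace.euclideanHausdorffMeasure_eq_volume, volume_rankOneMap_image, hb] at key
  have e : |1 + a * (1 - q ^ 2)| = q⁻¹ := by
    have : 1 + a * (1 - q ^ 2) = q⁻¹ := by simp only [a]; field_simp; ring
    rw [this, abs_of_pos (by positivity)]
  rw [e] at key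
  simpa using key

/-- A map which is close to a linear map with nontrivial kernel has small images. -/
theorem ApproximatesLinearOn.euclideanHausdorffMeasure_image_le {m N : ℕ} {f : Euc m → Euc N}
    {A : Euc m →L[ℝ] Euc N} {K lam : ℝ≥0} (hA : ‖A‖ ≤ K) {k : Euc m} (hk : ‖k‖ = 1) (hAk : A k = 0)
    (hlam : 0 < lam) (hlam1 : lam ≤ 1) {s : Set (Euc m)} (hf : ApproximatesLinearOn f A s lam) :
    μHE[m] (f '' s) ≤ ((K + 1 : ℝ≥0) : ℝ≥0∞) ^ m * (lam * volume s) := by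
  have hl : (0 : ℝ) < lam := by exact_mod_cast hlam
  have hl1 : (lam : ℝ) ≤ 1 := by exact_mod_cast hlam1
  have key := euclideanHausdorffMeasure_image_le_of_dist_le (K := K + 1) (s := s)
    (f := f) (g := fun x => rankOneMap (lam - 1 : ℝ) k x) (by
      intro x hx y hy
      rw [dist_eq_norm, dist_eq_norm, ← map_sub]
      set w := x - y
      have h1 : ‖f x - f y - A w‖ ≤ lam * ‖w‖ := hf x hx y hy
      have h2 : A w = A (w - ⟪k, w⟫ • k) := by
        rw [map_sub A w, map_smul, hAk, smul_zero, sub_zero]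
      have h3 : ‖w - ⟪k, w⟫ • k‖ ≤ ‖rankOneMap (lam - 1 : ℝ) k w‖ := by
        refine abs_le_of_sq_le_sq' ?_ (by positivity) |>.2
        rw [norm_rankOneMap_sq, norm_sub_sq_real, inner_smul_right, norm_smul, mul_pow, hk,
          Real.norm_eq_abs, sq_abs, real_inner_comm k w]
        nlinarith [mul_nonneg (sq_nonneg (lam : ℝ)) (sq_nonneg ⟪k, w⟫)]
      have h4 : lam * ‖w‖ ≤ ‖rankOneMap (lam - 1 : ℝ) k w‖ := by
        refine abs_le_of_sq_le_sq' ?_ (by positivity) |>.2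
        rw [norm_rankOneMap_sq, mul_pow, hk]
        have h5 : ⟪k, w⟫ ^ 2 ≤ ‖w‖ ^ 2 := by
          rw [← sq_abs]
          have := abs_real_inner_le_norm k w
          rw [hk, one_mul] at this
          gcongr
        have h6 : (lam : ℝ) ^ 2 ≤ 1 := by nlinarith
        nlinarith [mul_nonneg (sub_nonneg.2 h6) (sub_nonneg.2 h5)]
      have h7 : ‖A w‖ ≤ K * ‖rankOneMap (lam - 1 : ℝ) k w‖ := by
        rw [h2]
        exact (A.le_opNorm _).trans (by gcongr)
      have h8 : f x - f y = (f x - f y - A w) + A w := by abel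
      calc ‖f x - f y‖ ≤ ‖f x - f y - A w‖ + ‖A w‖ := by
            conv_lhs => rw [h8]
            exact norm_add_le _ _
        _ ≤ _ := by push_cast; nlinarith) m
  rw [EuclideanSpace.euclideanHausdorffMeasure_eq_volume, volume_rankOneMap_image, hk] at key
  have e : ENNReal.ofReal |1 + (lam - 1 : ℝ) * (1 : ℝ) ^ 2| = lam := by
    rw [one_pow, mul_one, add_sub_cancel, abs_of_pos hl, ENNReal.ofReal_coe_nnreal]
  rwa [e] at key

end

noncomputable section

open scoped RealInnerProductSpace ENNReal

section eilenberg
open Filter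

variable {X Z : Type*} [MeasurableSpace X] [MeasurableSpace Z] {μ : Measure X} {ν : Measure Z}

theorem exists_measurable_tsum_fiber_indicator_one_le [MeasurableSpace.CountablySeparated X]
    {P : X → Z} {S : Set X} (hS : MeasurableSet S) {lam : ℝ≥0∞}
    (h : ∀ S' ⊆ S, MeasurableSet S' → ν (P '' S') ≤ lam * μ S') :
    ∃ G : Z → ℝ≥0∞, Measurable G ∧
      (∀ z, ∑' x : P ⁻¹' {z}, S.indicator (fun _ => (1 : ℝ≥0∞)) (x : X) ≤ G z) ∧
      ∫⁻ z, G z ∂ν ≤ lam * μ S := by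
  classical
  obtain ⟨f, hf, hinj⟩ := MeasurableSpace.measurable_injection_nat_bool_of_countablySeparated X
  set key : (n : ℕ) → X → (Fin n → Bool) := fun n x k => f x k with hkey
  have hkm : ∀ n, Measurable (key n) := fun n =>
    measurable_pi_lambda _ fun k => (measurable_pi_apply _).comp hf
  set cell : (n : ℕ) → (Fin n → Bool) → Set X := fun n κ => S ∩ key n ⁻¹' {κ}
  have hcm : ∀ n κ, MeasurableSet (cell n κ) := fun n κ =>
    hS.inter (hkm n (measurableSet_singleton κ))
  set g : ℕ → Z → ℝ≥0∞ := fun n z =>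
    ∑ κ, (toMeasurable ν (P '' cell n κ)).indicator (fun _ => (1 : ℝ≥0∞)) z
  have hg : ∀ n, Measurable (g n) := fun n =>
    Finset.measurable_sum _ fun κ _ => measurable_const.indicator (measurableSet_toMeasurable _ _)
  have hgi : ∀ n, ∫⁻ z, g n z ∂ν ≤ lam * μ S := fun n => by
    rw [lintegral_finsetSum _ fun κ _ =>
      measurable_const.indicator (measurableSet_toMeasurable _ _)]
    calc _ = ∑ κ, ν (P '' cell n κ) := by
          refine Finset.sum_congr rfl fun κ _ => ?_
          rw [lintegral_indicator_const (measurableSet_toMeasurable _ _), one_mul,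
            measure_toMeasurable]
      _ ≤ ∑ κ, lam * μ (cell n κ) :=
          Finset.sum_le_sum fun κ _ => h _ inter_subset_left (hcm n κ)
      _ = lam * μ (⋃ κ, cell n κ) := by
          rw [← Finset.mul_sum, measure_iUnion _ (hcm n), tsum_fintype]
          intro κ κ' hne
          refine disjoint_left.2 fun x hx hx' => hne ?_
          rw [← show key n x = κ from hx.2, ← show key n x = κ' from hx'.2]
      _ ≤ _ := by gcongr; exact iUnion_subset fun κ => inter_subset_left
  refine ⟨fun z => liminf (fun n => g n z) atTop, Measurable.liminf hg, fun z => ?_, ?_⟩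
  · rw [ENNReal.tsum_eq_iSup_sum]
    refine iSup_le fun t => ?_
    refine le_liminf_of_le (by isBoundedDefault) ?_
    have hev : ∀ᶠ n in atTop, ∀ x ∈ t, ∀ y ∈ t, key n x = key n y → x = y := by
      simp only [Finset.eventually_all]
      intro x _ y _
      by_cases hxy : x = y
      · exact Eventually.of_forall fun _ _ => hxy
      · have : f x ≠ f y := fun e => hxy (Subtype.ext (hinj e))
        obtain ⟨k, hk⟩ := Function.ne_iff.1 this
        filter_upwards [eventually_gt_atTop k] with n hn e
        exact absurd (congrFun e ⟨k, hn⟩) hk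
    filter_upwards [hev] with n hn
    have e : ∑ x ∈ t, S.indicator (fun _ => (1 : ℝ≥0∞)) (x : X)
        = ∑ x ∈ t.filter (fun x : P ⁻¹' {z} => (x : X) ∈ S), 1 := by
      rw [Finset.sum_filter]
      exact Finset.sum_congr rfl fun x _ => by rw [indicator_apply]
    rw [e]
    have hinj' : Set.InjOn (fun x : P ⁻¹' {z} => key n x)
        ((t.filter fun x : P ⁻¹' {z} => (x : X) ∈ S : Finset _) : Set _) :=
      fun x hx y hy e => hn x (Finset.mem_filter.1 hx).1 y (Finset.mem_filter.1 hy).1 e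
    rw [← Finset.sum_image (f := fun _ => (1 : ℝ≥0∞)) hinj']
    refine (Finset.sum_le_sum (g := fun κ =>
      (toMeasurable ν (P '' cell n κ)).indicator (fun _ => (1 : ℝ≥0∞)) z) ?_).trans
      (Finset.sum_le_univ_sum_of_nonneg fun _ => zero_le)
    intro κ hκ
    obtain ⟨x, hx, rfl⟩ := Finset.mem_image.1 hκ
    rw [indicator_of_mem]
    exact subset_toMeasurable _ _ ⟨x, ⟨(Finset.mem_filter.1 hx).2, rfl⟩, x.2⟩
  · refine (lintegral_liminf_le hg).trans ?_
    exact liminf_le_of_frequently_le' (Frequently.of_forall hgi)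

theorem exists_measurable_tsum_fiber_le [MeasurableSpace.CountablySeparated X]
    {P : X → Z} {A : Set X} (hA : MeasurableSet A) {lam : ℝ≥0∞}
    (h : ∀ S ⊆ A, MeasurableSet S → ν (P '' S) ≤ lam * μ S) {f : X → ℝ≥0∞} (hf : Measurable f) :
    ∃ G : Z → ℝ≥0∞, Measurable G ∧
      (∀ z, ∑' x : P ⁻¹' {z}, A.indicator f (x : X) ≤ G z) ∧
      ∫⁻ z, G z ∂ν ≤ lam * ∫⁻ x in A, f x ∂μ := by
  refine Measurable.ennreal_induction (motive := fun f => ∃ G : Z → ℝ≥0∞, Measurable G ∧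
      (∀ z, ∑' x : P ⁻¹' {z}, A.indicator f (x : X) ≤ G z) ∧
      ∫⁻ z, G z ∂ν ≤ lam * ∫⁻ x in A, f x ∂μ) ?_ ?_ ?_ hf
  · intro c s hs
    obtain ⟨G, hG, h1, h2⟩ := exists_measurable_tsum_fiber_indicator_one_le (hA.inter hs)
      (fun S' hS' => h S' (hS'.trans inter_subset_left))
    refine ⟨fun z => c * G z, hG.const_mul c, fun z => ?_, ?_⟩
    · refine le_trans (le_of_eq ?_) (mul_le_mul' le_rfl (h1 z))
      rw [← ENNReal.tsum_mul_left]
      refine tsum_congr fun x => ?_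
      rw [indicator_indicator]
      by_cases hx : (x : X) ∈ A ∩ s <;> simp [hx]
    · rw [lintegral_const_mul _ hG, lintegral_indicator_const hs, Measure.restrict_apply hs,
        inter_comm s A]
      calc c * _ ≤ c * (lam * μ (A ∩ s)) := mul_le_mul' le_rfl h2
        _ = _ := by ring
  · intro f g _ hf hg hF hG
    obtain ⟨F', hF, h1, h2⟩ := hF
    obtain ⟨G', hG, h3, h4⟩ := hG
    refine ⟨fun z => F' z + G' z, hF.add hG, fun z => ?_, ?_⟩
    · have : ∀ x : X, A.indicator (f + g) x = A.indicator f x + A.indicator g x := fun x => by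
        by_cases hx : x ∈ A <;> simp [hx]
      simp_rw [this]
      rw [ENNReal.tsum_add]
      exact add_le_add (h1 z) (h3 z)
    · rw [lintegral_add_left hF]
      simp only [Pi.add_apply]
      rw [lintegral_add_left hf, mul_add]
      exact add_le_add h2 h4
  · intro f hf hmono hF
    choose G hG h1 h2 using hF
    refine ⟨fun z => liminf (fun n => G n z) atTop, Measurable.liminf hG, fun z => ?_, ?_⟩
    · rw [ENNReal.tsum_eq_iSup_sum]
      refine iSup_le fun t => ?_
      have e : ∑ x ∈ t, A.indicator (fun x => ⨆ n, f n x) (x : X)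
          = ⨆ n, ∑ x ∈ t, A.indicator (f n) (x : X) := by
        rw [← ENNReal.finsetSum_iSup_of_monotone]
        · refine Finset.sum_congr rfl fun x _ => ?_
          by_cases hx : (x : X) ∈ A <;> simp [hx]
        · intro x n k hnk
          exact indicator_le_indicator (hmono hnk x)
      rw [e]
      refine iSup_le fun n => le_liminf_of_le (by isBoundedDefault) ?_
      filter_upwards [eventually_ge_atTop n] with k hk
      refine (Finset.sum_le_sum (g := fun x : P ⁻¹' {z} => A.indicator (f k) (x : X))
        fun x _ => indicator_le_indicator (hmono hk x)).trans ?_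
      exact (ENNReal.sum_le_tsum t).trans (h1 k z)
    · refine (lintegral_liminf_le hG).trans ?_
      refine liminf_le_of_frequently_le' (Frequently.of_forall fun n => (h2 n).trans ?_)
      gcongr
      exact le_iSup (fun n => f n _) n

/-- An Eilenberg type inequality: integrating over the fibers of a map which decreases measures. -/
theorem lintegral_tsum_fiber_le [MeasurableSpace.CountablySeparated X]
    {P : X → Z} {A : Set X} (hA : MeasurableSet A) {lam : ℝ≥0∞}
    (h : ∀ S ⊆ A, MeasurableSet S → ν (P '' S) ≤ lam * μ S) {f : X → ℝ≥0∞} (hf : Measurable f) :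
    ∫⁻ z, ∑' x : P ⁻¹' {z}, A.indicator f (x : X) ∂ν ≤ lam * ∫⁻ x in A, f x ∂μ := by
  obtain ⟨G, -, h1, h2⟩ := exists_measurable_tsum_fiber_le hA h hf
  exact (lintegral_mono h1).trans h2

end eilenberg

end

noncomputable section

open scoped RealInnerProductSpace ENNReal

section oneDim
open Filter Topology

theorem exists_abs_intervalIntegral_mul_deriv_sub_le {a g g' : ℝ → ℝ} {c : ℝ}
    (hac : ∀ s t, |a s - a t| ≤ c) (hg : ∀ t, HasDerivAt g (g' t) t) (hg' : Continuous g')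
    (S : Finset ℝ) {p q : ℝ} (hpq : p ≤ q) (hS : (S : Set ℝ) ⊆ Ioo p q)
    (hloc : ∀ t ∈ Ioo p q, t ∉ S → ∀ᶠ s in 𝓝 t, a s = a t) :
    IntervalIntegrable (fun t => a t * g' t) volume p q ∧
    ∃ al ∈ range a, ∃ ar ∈ range a,
      |(∫ t in p..q, a t * g' t) - (ar * g q - al * g p)| ≤ c * ∑ s ∈ S, |g s| := by
  induction hn : S.card using Nat.strong_induction_on generalizing S p q with
  | _ n ih =>
    rcases S.eq_empty_or_nonempty with rfl | ⟨s, hs⟩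
    · have hconst : ∃ b ∈ range a, ∀ t ∈ Ioo p q, a t = b := by
        rcases (Ioo p q).eq_empty_or_nonempty with he | ⟨t₀, ht₀⟩
        · exact ⟨a 0, mem_range_self _, by simp [he]⟩
        · refine ⟨a t₀, mem_range_self _, fun t ht => ?_⟩
          have hd : ∀ t ∈ Ioo p q, HasDerivAt a 0 t := fun t ht =>
            (hasDerivAt_const t (a t)).congr_of_eventuallyEq (hloc t ht (by simp))
          exact isOpen_Ioo.is_const_of_deriv_eq_zero isPreconnected_Ioo
            (fun t ht => (hd t ht).differentiableAt.differentiableWithinAt)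
            (fun t ht => (hd t ht).deriv) ht ht₀
      obtain ⟨b, hb, hab⟩ := hconst
      have hae : ∀ᵐ t ∂(volume : Measure ℝ), t ∈ Ioc p q → a t * g' t = b * g' t := by
        filter_upwards [compl_mem_ae_iff.2 (measure_singleton q)] with t ht htp
        rw [hab t ⟨htp.1, lt_of_le_of_ne htp.2 ht⟩]
      rw [← uIoc_of_le hpq] at hae
      have hint : IntervalIntegrable (fun t => b * g' t) volume p q :=
        (hg'.intervalIntegrable p q).const_mul b
      refine ⟨hint.congr_ae ?_, b, hb, b, hb, ?_⟩
      · rw [EventuallyEq, ae_restrict_iff' measurableSet_uIoc]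
        filter_upwards [hae] with t ht htm using (ht htm).symm
      · rw [intervalIntegral.integral_congr_ae hae, intervalIntegral.integral_const_mul,
          intervalIntegral.integral_eq_sub_of_hasDerivAt (fun t _ => hg t)
            (hg'.intervalIntegrable p q)]
        simp [mul_sub]
    · have hsp := hS hs
      have hlt1 : (S.filter (· < s)).card < n := by
        rw [← hn]; exact Finset.card_lt_card (Finset.filter_ssubset.2 ⟨s, hs, lt_irrefl s⟩)
      have hlt2 : (S.filter (s < ·)).card < n := by
        rw [← hn]; exact Finset.card_lt_card (Finset.filter_ssubset.2 ⟨s, hs, lt_irrefl s⟩)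
      obtain ⟨i1, al, hal, b1, hb1, h1⟩ := ih _ hlt1 (S.filter (· < s)) hsp.1.le
        (fun t ht => by
          have := Finset.mem_filter.1 ht
          exact ⟨(hS this.1).1, this.2⟩)
        (fun t ht htS => hloc t ⟨ht.1, ht.2.trans hsp.2⟩ fun h =>
          htS (Finset.mem_filter.2 ⟨h, ht.2⟩)) rfl
      obtain ⟨i2, b2, hb2, ar, har, h2⟩ := ih _ hlt2 (S.filter (s < ·)) hsp.2.le
        (fun t ht => by
          have := Finset.mem_filter.1 ht
          exact ⟨this.2, (hS this.1).2⟩)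
        (fun t ht htS => hloc t ⟨hsp.1.trans ht.1, ht.2⟩ fun h =>
          htS (Finset.mem_filter.2 ⟨h, ht.1⟩)) rfl
      refine ⟨i1.trans i2, al, hal, ar, har, ?_⟩
      rw [← intervalIntegral.integral_add_adjacent_intervals i1 i2]
      obtain ⟨x1, rfl⟩ := hb1
      obtain ⟨x2, rfl⟩ := hb2
      have h3 : |(a x1 - a x2) * g s| ≤ c * |g s| := by
        rw [abs_mul]; gcongr; exact hac x1 x2
      have hsum : ∑ t ∈ S, |g t| =
          ∑ t ∈ S.filter (· < s), |g t| + |g s| + ∑ t ∈ S.filter (s < ·), |g t| := by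
        rw [← Finset.sum_filter_add_sum_filter_not S (· < s), add_assoc]
        congr 1
        have : S.filter (fun t => ¬ t < s) = insert s (S.filter (s < ·)) := by
          ext t
          simp only [Finset.mem_filter, Finset.mem_insert, not_lt]
          constructor
          · rintro ⟨h, h'⟩
            rcases h'.eq_or_lt with e | e
            · exact Or.inl e.symm
            · exact Or.inr ⟨h, e⟩
          · rintro (rfl | ⟨h, h'⟩)
            · exact ⟨hs, le_rfl⟩
            · exact ⟨h, h'.le⟩
        rw [this, Finset.sum_insert (by simp)]
      rw [hsum]
      rw [abs_le] at h1 h2 h3 ⊢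
      constructor <;> nlinarith

end oneDim

section lineIntegral
open Filter Topology

variable {m : ℕ} (T : Euc (m + 1) ≃ₗᵢ[ℝ] Euc (m + 1))

theorem enorm_integral_mul_fderiv_frameAxis_le {F : Set (Euc (m + 1))} (hF : IsClosed F)
    (hFfin : ∀ r, μHE[m] (F ∩ closedBall 0 r) < ⊤) {a : Euc (m + 1) → ℝ} (ha : Measurable a)
    {c : ℝ} (hac : ∀ x y, |a x - a y| ≤ c) (hloc : ∀ x ∉ F, ∀ᶠ y in 𝓝 x, a y = a x)
    {ζ : Euc (m + 1) → ℝ} (hζ : ContDiff ℝ 1 ζ) (hζc : HasCompactSupport ζ) :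
    ‖∫ x, a x * fderiv ℝ ζ x (frameAxis T)‖ₑ ≤ ENNReal.ofReal c *
      ∫⁻ z, ∑' x : frameProj T ⁻¹' {z}, F.indicator (fun x => ‖ζ x‖ₑ) (x : Euc (m + 1)) := by
  have hc : 0 ≤ c := (abs_nonneg _).trans (hac 0 0)
  set h : Euc (m + 1) → ℝ := fun x => a x * fderiv ℝ ζ x (frameAxis T) with hh
  have hDc : Continuous fun x => fderiv ℝ ζ x (frameAxis T) :=
    (hζ.continuous_fderiv one_ne_zero).clm_apply continuous_const
  have hDs : HasCompactSupport fun x => fderiv ℝ ζ x (frameAxis T) :=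
    hζc.fderiv_apply ℝ (frameAxis T)
  have hint : Integrable h := by
    refine (hDc.integrable_of_hasCompactSupport hDs).bdd_mul (c := |a 0| + c)
      ha.aestronglyMeasurable (Eventually.of_forall fun x => ?_)
    rw [Real.norm_eq_abs]
    have := hac x 0
    have h2 := abs_sub_abs_le_abs_sub (a x) (a 0)
    linarith
  have hmp := measurePreserving_framePoint T
  have e1 : ∫ x, h x = ∫ p : Euc m × ℝ, h (framePoint T p.1 p.2) ∂(volume.prod volume) := by
    rw [← hmp.map_eq] at hint ⊢
    exact integral_map hmp.measurable.aemeasurable hint.aestronglyMeasurable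
  have hint' : Integrable (fun p : Euc m × ℝ => h (framePoint T p.1 p.2))
      (volume.prod volume) := hmp.integrable_comp_of_integrable hint
  rw [e1, integral_prod _ hint']
  refine (enorm_integral_le_lintegral_enorm _).trans ?_
  rw [← lintegral_const_mul' _ _ ENNReal.ofReal_ne_top]
  refine lintegral_mono_ae ?_
  -- almost every line meets `F` in a locally finite set
  have hfinite : ∀ᵐ z : Euc m, ∀ n : ℕ, {t | framePoint T z t ∈ F ∩ closedBall 0 n}.Finite := by
    rw [ae_all_iff]
    intro n
    have hA : MeasurableSet (F ∩ closedBall (0 : Euc (m + 1)) n) :=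
      (hF.inter isClosed_closedBall).measurableSet
    obtain ⟨G, hG, h1, h2⟩ := exists_measurable_tsum_fiber_indicator_one_le (μ := μHE[m])
      (ν := (volume : Measure (Euc m))) (P := frameProj T) hA (lam := 1)
      (fun S' _ _ => by rw [one_mul]; exact volume_frameProj_image_le T S')
    have h3 : ∫⁻ z, G z ≠ ⊤ := (h2.trans_lt (by rw [one_mul]; exact hFfin n)).ne
    filter_upwards [ae_lt_top hG h3] with z hz
    have h4 := ((h1 z).trans_lt hz).ne
    have h5 := ENNReal.finite_const_le_of_tsum_ne_top h4 (ε := 1) one_ne_zero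
    refine Set.Finite.of_finite_image (f := framePoint T z) ?_ ?_
    · refine (h5.image Subtype.val).subset ?_
      rintro _ ⟨t, ht, rfl⟩
      refine ⟨⟨framePoint T z t, by simp⟩, ?_, rfl⟩
      change 1 ≤ (F ∩ closedBall 0 (n : ℝ)).indicator (fun _ => (1 : ℝ≥0∞)) (framePoint T z t)
      exact (indicator_of_mem (f := fun _ => (1 : ℝ≥0∞))
        (show framePoint T z t ∈ F ∩ closedBall 0 (n : ℝ) from ht)).ge
    · intro t _ t' _ e
      have := congrArg (fun x => ⟪frameAxis T, x⟫) e
      simpa using this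
  obtain ⟨r, hr⟩ := hζc.isCompact.isBounded.subset_closedBall 0
  filter_upwards [hfinite] with z hz
  set g : ℝ → ℝ := fun t => ζ (framePoint T z t)
  set g' : ℝ → ℝ := fun t => fderiv ℝ ζ (framePoint T z t) (frameAxis T)
  have hfp : ∀ t, HasDerivAt (fun t => framePoint T z t) (frameAxis T) t := fun t => by
    have : (fun t => framePoint T z t) = fun t : ℝ => framePoint T z 0 + t • frameAxis T := by
      ext1 t; exact framePoint_eq_add T z t
    rw [this]
    simpa using ((hasDerivAt_id t).smul_const (frameAxis T)).const_add (framePoint T z 0)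
  have hfpc : Continuous fun t => framePoint T z t :=
    continuous_iff_continuousAt.2 fun t => (hfp t).continuousAt
  have hg : ∀ t, HasDerivAt g (g' t) t := fun t =>
    ((hζ.differentiable one_ne_zero _).hasFDerivAt).comp_hasDerivAt t (hfp t)
  have hg' : Continuous g' := hDc.comp hfpc
  set R : ℝ := |r| + 1
  have hRpos : 0 < R := by positivity
  have hfar : ∀ t, R ≤ |t| → framePoint T z t ∉ tsupport ζ := fun t ht hmem => by
    have h1 := hr hmem
    rw [mem_closedBall_zero_iff] at h1
    have h2 := abs_real_inner_le_norm (frameAxis T) (framePoint T z t)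
    rw [inner_frameAxis_framePoint, norm_frameAxis, one_mul] at h2
    have := le_abs_self r
    simp only [R] at ht
    linarith
  have hSfin : {t | t ∈ Ioo (-R) R ∧ framePoint T z t ∈ F}.Finite := by
    obtain ⟨n, hn⟩ := exists_nat_ge (‖framePoint T z 0‖ + R)
    refine (hz n).subset fun t ht => ⟨ht.2, ?_⟩
    rw [mem_closedBall_zero_iff, framePoint_eq_add]
    refine (norm_add_le _ _).trans (le_trans ?_ hn)
    rw [norm_smul, norm_frameAxis, mul_one, Real.norm_eq_abs]
    have := abs_lt.2 ⟨ht.1.1, ht.1.2⟩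
    linarith
  set S := hSfin.toFinset
  have hmS : ∀ t, t ∈ S ↔ t ∈ Ioo (-R) R ∧ framePoint T z t ∈ F := fun t => by simp [S]
  obtain ⟨-, al, -, ar, -, hest⟩ := exists_abs_intervalIntegral_mul_deriv_sub_le
    (a := fun t => a (framePoint T z t)) (fun s t => hac _ _) hg hg' S (p := -R) (q := R)
    (by linarith) (fun t ht => ((hmS t).1 ht).1) (fun t ht htS =>
      hfpc.continuousAt.eventually (hloc _ fun hh => htS ((hmS t).2 ⟨ht, hh⟩)))
  have hgR : g R = 0 := image_eq_zero_of_notMem_tsupport (f := ζ) (hfar R (le_abs_self R))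
  have hgR' : g (-R) = 0 :=
    image_eq_zero_of_notMem_tsupport (f := ζ) (hfar (-R) (by rw [abs_neg]; exact le_abs_self R))
  rw [hgR, hgR', mul_zero, mul_zero, sub_zero, sub_zero] at hest
  have e2 : ∫ t, h (framePoint T z t) = ∫ t in (-R)..R, a (framePoint T z t) * g' t := by
    rw [intervalIntegral.integral_of_le (by linarith)]
    refine (setIntegral_eq_integral_of_forall_compl_eq_zero fun t ht => ?_).symm
    have : R ≤ |t| := by
      by_contra! hlt
      exact ht ⟨(abs_lt.1 hlt).1, (abs_lt.1 hlt).2.le⟩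
    have h0 : framePoint T z t ∉ tsupport (fderiv ℝ ζ) := fun hm =>
      hfar t this (tsupport_fderiv_subset ℝ hm)
    simp only [hh, image_eq_zero_of_notMem_tsupport h0]
    simp
  change ‖∫ t, h (framePoint T z t)‖ₑ ≤ _
  rw [e2, Real.enorm_eq_ofReal_abs]
  refine (ENNReal.ofReal_le_ofReal hest).trans ?_
  rw [ENNReal.ofReal_mul hc]
  gcongr
  rw [ENNReal.ofReal_sum_of_nonneg fun _ _ => abs_nonneg _]
  have hinj : Function.Injective fun t : ℝ => (⟨framePoint T z t, by simp⟩ : frameProj T ⁻¹' {z}) :=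
    fun t t' e => by
      have := congrArg (fun x : frameProj T ⁻¹' {z} => ⟪frameAxis T, (x : Euc (m + 1))⟫) e
      simpa using this
  have e3 : ∑ s ∈ S, ENNReal.ofReal |g s| = ∑ x ∈ S.map ⟨_, hinj⟩,
      F.indicator (fun x => ‖ζ x‖ₑ) (x : Euc (m + 1)) := by
    rw [Finset.sum_map]
    refine Finset.sum_congr rfl fun s hs => ?_
    simp only [Function.Embedding.coeFn_mk]
    rw [indicator_of_mem ((hmS s).1 hs).2, Real.enorm_eq_ofReal_abs]
  rw [e3]
  exact ENNReal.sum_le_tsum _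

theorem enorm_integral_mul_fderiv_frameAxis_le_of_subset {F : Set (Euc (m + 1))} (hF : IsClosed F)
    (hFfin : ∀ r, μHE[m] (F ∩ closedBall 0 r) < ⊤) {a : Euc (m + 1) → ℝ} (ha : Measurable a)
    {c : ℝ} (hac : ∀ x y, |a x - a y| ≤ c) (hloc : ∀ x ∉ F, ∀ᶠ y in 𝓝 x, a y = a x)
    {ζ : Euc (m + 1) → ℝ} (hζ : ContDiff ℝ 1 ζ) (hζc : HasCompactSupport ζ)
    {K : Set (Euc (m + 1))} (hK : MeasurableSet K) (hKF : K ⊆ F) {lam : ℝ≥0∞}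
    (hlam : ∀ S ⊆ K, volume (frameProj T '' S) ≤ lam * μHE[m] S) :
    ‖∫ x, a x * fderiv ℝ ζ x (frameAxis T)‖ₑ ≤ ENNReal.ofReal c *
      (lam * ∫⁻ x in K, ‖ζ x‖ₑ ∂μHE[m] + ∫⁻ x in F \ K, ‖ζ x‖ₑ ∂μHE[m]) := by
  refine (enorm_integral_mul_fderiv_frameAxis_le T hF hFfin ha hac hloc hζ hζc).trans ?_
  gcongr
  have hζm : Measurable fun x => ‖ζ x‖ₑ := hζ.continuous.measurable.enorm
  obtain ⟨G, hG, h1, h2⟩ : ∃ G : Euc m → ℝ≥0∞, Measurable G ∧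
      (∀ z, ∑' x : frameProj T ⁻¹' {z}, K.indicator (fun x => ‖ζ x‖ₑ) (x : Euc (m + 1)) ≤ G z) ∧
      ∫⁻ z, G z ≤ lam * ∫⁻ x in K, ‖ζ x‖ₑ ∂μHE[m] :=
    exists_measurable_tsum_fiber_le hK (fun S hS _ => hlam S hS) hζm
  have e : ∀ x, F.indicator (fun x => ‖ζ x‖ₑ) x =
      K.indicator (fun x => ‖ζ x‖ₑ) x + (F \ K).indicator (fun x => ‖ζ x‖ₑ) x := fun x => by
    by_cases hx : x ∈ K
    · simp [hx, hKF hx]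
    · by_cases hx' : x ∈ F <;> simp [hx, hx']
  simp_rw [e, ENNReal.tsum_add]
  refine (lintegral_mono fun z => add_le_add_left (h1 z) _).trans ?_
  rw [lintegral_add_left hG]
  refine add_le_add h2 ?_
  simpa using lintegral_tsum_fiber_le (μ := μHE[m]) (ν := (volume : Measure (Euc m)))
    (P := frameProj T) (lam := 1) (hF.measurableSet.diff hK)
    (fun S _ _ => by rw [one_mul]; exact volume_frameProj_image_le T S) hζm

theorem enorm_integral_mul_fderiv_frameAxis_le_setLIntegral {F : Set (Euc (m + 1))}
    (hF : IsClosed F)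
    (hFfin : ∀ r, μHE[m] (F ∩ closedBall 0 r) < ⊤) {a : Euc (m + 1) → ℝ} (ha : Measurable a)
    {c : ℝ} (hac : ∀ x y, |a x - a y| ≤ c) (hloc : ∀ x ∉ F, ∀ᶠ y in 𝓝 x, a y = a x)
    {ζ : Euc (m + 1) → ℝ} (hζ : ContDiff ℝ 1 ζ) (hζc : HasCompactSupport ζ) :
    ‖∫ x, a x * fderiv ℝ ζ x (frameAxis T)‖ₑ ≤
      ENNReal.ofReal c * ∫⁻ x in F, ‖ζ x‖ₑ ∂μHE[m] := by
  simpa using enorm_integral_mul_fderiv_frameAxis_le_of_subset T hF hFfin ha hac hloc hζ hζc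
    MeasurableSet.empty (empty_subset F) (lam := 0) (by simp +contextual [subset_empty_iff])

end lineIntegral

end

noncomputable section

open scoped RealInnerProductSpace ENNReal

/-- A set all of whose secants are almost orthogonal to a unit vector. -/
def IsFlatSet {m : ℕ} (ε : ℝ) (K : Set (Euc (m + 1))) : Prop :=
  ∃ n : Euc (m + 1), ‖n‖ = 1 ∧ ∀ x ∈ K, ∀ y ∈ K, |⟪n, x - y⟫| ≤ ε * ‖x - y‖

theorem IsFlatSet.mono {m : ℕ} {ε : ℝ} {K K' : Set (Euc (m + 1))} (h : IsFlatSet ε K)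
    (hK : K' ⊆ K) : IsFlatSet ε K' := by
  obtain ⟨n, hn, h⟩ := h
  exact ⟨n, hn, fun x hx y hy => h x (hK hx) y (hK hy)⟩

theorem exists_norm_eq_one_forall_inner_eq_zero {m : ℕ} (A : Euc m →L[ℝ] Euc (m + 1)) :
    ∃ n : Euc (m + 1), ‖n‖ = 1 ∧ ∀ w, ⟪n, A w⟫ = 0 := by
  set V := A.toLinearMap.range
  have hV : V ≠ ⊤ := by
    intro h
    have h1 := A.toLinearMap.finrank_range_le
    have h2 : Module.finrank ℝ V = m + 1 := by rw [h]; simp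
    simp only [finrank_euclideanSpace, Fintype.card_fin] at h1
    change Module.finrank ℝ V ≤ m at h1
    omega
  have : Vᗮ ≠ ⊥ := fun h => hV ((Submodule.orthogonal_eq_bot_iff).1 h)
  obtain ⟨u, hu, hu0⟩ := Submodule.exists_mem_ne_zero_of_ne_bot this
  refine ⟨‖u‖⁻¹ • u, norm_smul_inv_norm hu0, fun w => ?_⟩
  have h : ⟪u, A w⟫ = 0 :=
    Submodule.inner_left_of_mem_orthogonal (LinearMap.mem_range_self A.toLinearMap w : A w ∈ V) hu
  rw [real_inner_smul_left, h, mul_zero]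

section rectifiable
variable {m : ℕ} {f : Euc m → Euc (m + 1)} {K : ℝ≥0}

theorem LipschitzWith.euclideanHausdorffMeasure_image_fderiv_kernel (hf : LipschitzWith K f) :
    μHE[m] (f '' {x | DifferentiableAt ℝ f x ∧ ∃ k, ‖k‖ = 1 ∧ fderiv ℝ f x k = 0}) = 0 := by
  set s := {x | DifferentiableAt ℝ f x ∧ ∃ k, ‖k‖ = 1 ∧ fderiv ℝ f x k = 0} with hs
  suffices H : ∀ j : ℕ, μHE[m] (f '' (s ∩ ball 0 j)) = 0 by
    have : s = ⋃ j : ℕ, s ∩ ball 0 j := by rw [← inter_iUnion, iUnion_ball_nat, inter_univ]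
    rw [this, image_iUnion]
    exact measure_iUnion_null H
  intro j
  have hest : ∀ lam : ℝ≥0, 0 < lam → lam ≤ 1 →
      μHE[m] (f '' (s ∩ ball 0 j)) ≤
        lam * (((K + 1 : ℝ≥0) : ℝ≥0∞) ^ m * volume (ball (0 : Euc m) j)) := by
    intro lam hlam hlam1
    rcases s.eq_empty_or_nonempty with he | hne
    · simp [he]
    obtain ⟨t, A, hdisj, htm, hst, happ, hA⟩ :=
      exists_partition_approximatesLinearOn_of_hasFDerivWithinAt f s (fderiv ℝ f)
        (fun x hx => hx.1.hasFDerivAt.hasFDerivWithinAt) (fun _ => lam) (fun _ => hlam.ne')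
    have hsub : f '' (s ∩ ball 0 j) ⊆ ⋃ n, f '' (s ∩ t n ∩ ball 0 j) := by
      rintro _ ⟨x, hx, rfl⟩
      obtain ⟨n, hn⟩ := mem_iUnion.1 (hst hx.1)
      exact mem_iUnion.2 ⟨n, x, ⟨⟨hx.1, hn⟩, hx.2⟩, rfl⟩
    calc μHE[m] (f '' (s ∩ ball 0 j)) ≤ ∑' n, μHE[m] (f '' (s ∩ t n ∩ ball 0 j)) :=
          (measure_mono hsub).trans (measure_iUnion_le _)
      _ ≤ ∑' n, ((K + 1 : ℝ≥0) : ℝ≥0∞) ^ m * (lam * volume (t n ∩ ball 0 j)) := by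
          refine ENNReal.tsum_le_tsum fun n => ?_
          obtain ⟨y, hy, hAy⟩ := hA hne n
          obtain ⟨-, k, hk, hyk⟩ := hy
          refine (ApproximatesLinearOn.euclideanHausdorffMeasure_image_le (K := K) (A := A n)
            (by rw [hAy]; exact norm_fderiv_le_of_lipschitz ℝ hf) hk (by rw [hAy, hyk]) hlam hlam1
            ((happ n).mono_set inter_subset_left)).trans ?_
          gcongr
          exact inter_subset_right
      _ = ((K + 1 : ℝ≥0) : ℝ≥0∞) ^ m * (lam * volume (⋃ n, t n ∩ ball 0 j)) := by
          rw [ENNReal.tsum_mul_left, ENNReal.tsum_mul_left, measure_iUnion]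
          · exact fun a b hab => (hdisj hab).mono inter_subset_left inter_subset_left
          · exact fun n => (htm n).inter measurableSet_ball
      _ ≤ ((K + 1 : ℝ≥0) : ℝ≥0∞) ^ m * (lam * volume (ball (0 : Euc m) j)) := by
          gcongr; exact iUnion_subset fun n => inter_subset_right
      _ = _ := by ring
  set C := ((K + 1 : ℝ≥0) : ℝ≥0∞) ^ m * volume (ball (0 : Euc m) j)
  have hC : C ≠ ⊤ := ENNReal.mul_ne_top (by simp) measure_ball_lt_top.ne
  refine le_antisymm (ENNReal.le_of_forall_pos_le_add fun δ hδ _ => ?_) zero_le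
  rw [zero_add]
  set lam : ℝ≥0 := min 1 (δ / (C.toNNReal + 1))
  have hl : 0 < lam := by positivity
  refine (hest lam hl (min_le_left _ _)).trans ?_
  rw [← ENNReal.coe_toNNReal hC, ← ENNReal.coe_mul, ENNReal.coe_le_coe]
  calc lam * C.toNNReal ≤ δ / (C.toNNReal + 1) * (C.toNNReal + 1) := by
        gcongr
        · exact min_le_right _ _
        · simp
    _ = δ := div_mul_cancel₀ _ (by positivity)

theorem LipschitzWith.exists_countable_isFlatSet_cover (hf : LipschitzWith K f) {ε : ℝ}
    (hε : 0 < ε) : ∃ 𝒜 : Set (Set (Euc (m + 1))), 𝒜.Countable ∧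
      (∀ A ∈ 𝒜, IsCompact A ∧ IsFlatSet ε A) ∧ μHE[m] (range f \ ⋃₀ 𝒜) = 0 := by
  classical
  set s := {x | DifferentiableAt ℝ f x ∧ ∀ k, ‖k‖ = 1 → fderiv ℝ f x k ≠ 0} with hs
  have hkap : ∀ A : Euc m →L[ℝ] Euc (m + 1), (∀ k, ‖k‖ = 1 → A k ≠ 0) →
      ∃ κ : ℝ≥0, 0 < κ ∧ ∀ w, κ * ‖w‖ ≤ ‖A w‖ := by
    intro A hA
    have hker : A.toLinearMap.ker = ⊥ := by
      rw [LinearMap.ker_eq_bot']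
      intro w hw
      by_contra hw0
      refine hA (‖w‖⁻¹ • w) (norm_smul_inv_norm hw0) ?_
      rw [map_smul, show A w = 0 from hw, smul_zero]
    obtain ⟨κ, hκ, hanti⟩ := A.toLinearMap.exists_antilipschitzWith hker
    refine ⟨κ⁻¹, by positivity, fun w => ?_⟩
    have := hanti.le_mul_dist w 0
    rw [dist_zero_right, map_zero, dist_zero_right] at this
    rw [NNReal.coe_inv, inv_mul_le_iff₀ (by exact_mod_cast hκ)]
    exact this
  set r : (Euc m →L[ℝ] Euc (m + 1)) → ℝ≥0 := fun A =>
    if h : ∀ k, ‖k‖ = 1 → A k ≠ 0 then ε.toNNReal * (hkap A h).choose / (1 + ε.toNNReal) else 1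
  have hεn : 0 < ε.toNNReal := Real.toNNReal_pos.2 hε
  have hr : ∀ A, r A ≠ 0 := fun A => by
    by_cases h : ∀ k, ‖k‖ = 1 → A k ≠ 0
    · simp only [r, dif_pos h]
      have := (hkap A h).choose_spec.1
      positivity
    · simp only [r, dif_neg h]; exact one_ne_zero
  obtain ⟨t, A, hdisj, htm, hst, happ, hA⟩ :=
      exists_partition_approximatesLinearOn_of_hasFDerivWithinAt f s (fderiv ℝ f)
        (fun x hx => hx.1.hasFDerivAt.hasFDerivWithinAt) r hr
  refine ⟨range fun p : ℕ × ℕ => f '' (closure (s ∩ t p.1) ∩ closedBall 0 p.2),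
    countable_range _, ?_, ?_⟩
  · rintro _ ⟨⟨n, j⟩, rfl⟩
    refine ⟨((isCompact_closedBall _ _).inter_left isClosed_closure).image hf.continuous, ?_⟩
    refine IsFlatSet.mono ?_ (image_mono inter_subset_left)
    obtain ⟨u, hu, hu0⟩ := exists_norm_eq_one_forall_inner_eq_zero (A n)
    refine ⟨u, hu, ?_⟩
    have hsmall : ∀ x ∈ s ∩ t n, ∀ y ∈ s ∩ t n, |⟪u, f x - f y⟫| ≤ ε * ‖f x - f y‖ := by
      intro x hx y hy
      obtain ⟨y₀, hy₀, hAy⟩ := hA ⟨x, hx.1⟩ n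
      have hinj : ∀ k, ‖k‖ = 1 → A n k ≠ 0 := hAy ▸ hy₀.2
      set κ := (hkap (A n) hinj).choose
      have hκ : 0 < κ ∧ ∀ w, κ * ‖w‖ ≤ ‖A n w‖ := (hkap (A n) hinj).choose_spec
      have hκ0 : (0 : ℝ) < κ := by exact_mod_cast hκ.1
      have hrA : (r (A n) : ℝ) = ε * κ / (1 + ε) := by
        simp only [r, dif_pos hinj]
        push_cast
        rw [Real.coe_toNNReal _ hε.le]
      have h1 : ‖f x - f y - A n (x - y)‖ ≤ r (A n) * ‖x - y‖ := happ n x hx y hy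
      rw [hrA] at h1
      have h2 : ⟪u, f x - f y⟫ = ⟪u, f x - f y - A n (x - y)⟫ := by
        rw [inner_sub_right u (f x - f y), hu0, sub_zero]
      have h3 : |⟪u, f x - f y⟫| ≤ ‖f x - f y - A n (x - y)‖ := by
        rw [h2]; simpa [hu] using abs_real_inner_le_norm u (f x - f y - A n (x - y))
      have h4 := hκ.2 (x - y)
      have h5 : ‖A n (x - y)‖ ≤ ‖f x - f y‖ + ‖f x - f y - A n (x - y)‖ := by
        have := _root_.norm_sub_le (f x - f y) (f x - f y - A n (x - y))
        rwa [sub_sub_cancel] at this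
      refine h3.trans (h1.trans ?_)
      have h6 : (κ - ε * κ / (1 + ε)) * ‖x - y‖ ≤ ‖f x - f y‖ := by nlinarith
      have h7 : ε * κ / (1 + ε) = ε * (κ - ε * κ / (1 + ε)) := by field_simp; ring
      rw [h7, mul_assoc]
      gcongr
    have hcl : IsClosed {p : Euc m × Euc m | |⟪u, f p.1 - f p.2⟫| ≤ ε * ‖f p.1 - f p.2‖} := by
      have := hf.continuous
      have h1 : Continuous fun p : Euc m × Euc m => f p.1 - f p.2 := by fun_prop
      exact isClosed_le (continuous_const.inner h1).abs (continuous_const.mul h1.norm)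
    have hsub : closure ((s ∩ t n) ×ˢ (s ∩ t n)) ⊆
        {p : Euc m × Euc m | |⟪u, f p.1 - f p.2⟫| ≤ ε * ‖f p.1 - f p.2‖} :=
      closure_minimal (fun p hp => hsmall p.1 hp.1 p.2 hp.2) hcl
    rw [closure_prod_eq] at hsub
    rintro _ ⟨x, hx, rfl⟩ _ ⟨y, hy, rfl⟩
    exact hsub (mk_mem_prod hx hy)
  · have hnd : μHE[m] (f '' {x | ¬ DifferentiableAt ℝ f x}) = 0 := by
      have h1 : volume {x | ¬ DifferentiableAt ℝ f x} = 0 := hf.ae_differentiableAt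
      have h2 := hf.lipschitzOnWith (s := {x | ¬ DifferentiableAt ℝ f x})
        |>.euclideanHausdorffMeasure_image_le m
      rw [EuclideanSpace.euclideanHausdorffMeasure_eq_volume, h1, mul_zero] at h2
      exact le_antisymm h2 zero_le
    refine measure_mono_null ?_ (measure_union_null hnd
      hf.euclideanHausdorffMeasure_image_fderiv_kernel)
    rintro _ ⟨⟨x, rfl⟩, hx⟩
    by_cases hd : DifferentiableAt ℝ f x
    · refine Or.inr ⟨x, ⟨hd, ?_⟩, rfl⟩
      by_contra! hcon
      obtain ⟨n, hn⟩ := mem_iUnion.1 (hst (show x ∈ s from ⟨hd, hcon⟩))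
      obtain ⟨j, hj⟩ := exists_nat_ge ‖x‖
      exact hx ⟨_, ⟨(n, j), rfl⟩, x, ⟨subset_closure ⟨⟨hd, hcon⟩, hn⟩, by simpa using hj⟩, rfl⟩
    · exact Or.inl ⟨x, hd, rfl⟩

end rectifiable

section disjointify
open Filter Topology

theorem exists_finite_disjoint_isFlatSet {m : ℕ} {F : Set (Euc (m + 1))} (hF : IsClosed F)
    {R : ℝ} (hfin : μHE[m] (F ∩ closedBall 0 R) < ⊤) {ε : ℝ}
    {𝒜 : Set (Set (Euc (m + 1)))} (hc : 𝒜.Countable)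
    (hA : ∀ A ∈ 𝒜, IsCompact A ∧ IsFlatSet ε A) (hcov : μHE[m] (F \ ⋃₀ 𝒜) = 0)
    {η : ℝ≥0∞} (hη : η ≠ 0) :
    ∃ (N : ℕ) (K : Fin (N + 1) → Set (Euc (m + 1))), (∀ i, IsCompact (K i)) ∧ (∀ i, K i ⊆ F) ∧
      (∀ i, IsFlatSet ε (K i)) ∧ Pairwise (Function.onFun Disjoint K) ∧
      μHE[m] ((F ∩ closedBall 0 R) \
        (⋃ i, K i)) ≤ η := by
  rcases 𝒜.eq_empty_or_nonempty with he | hne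
  · refine ⟨0, fun _ => ∅, by simp, by simp,
      fun i => ⟨EuclideanSpace.single 0 1, by simp, by simp⟩, fun i j _ => disjoint_empty _, ?_⟩
    refine le_trans (measure_mono (t := F \ ⋃₀ 𝒜) ?_) (hcov ▸ zero_le)
    rw [he]; simp [inter_subset_left]
  obtain ⟨A, rfl⟩ := hc.exists_eq_range hne
  have hA' : ∀ n, IsCompact (A n) ∧ IsFlatSet ε (A n) := fun n => hA _ (mem_range_self n)
  set B := F ∩ closedBall (0 : Euc (m + 1)) R
  have hBm : MeasurableSet B := (hF.inter isClosed_closedBall).measurableSet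
  set μ := (μHE[m] : Measure (Euc (m + 1))).restrict B
  have : IsFiniteMeasure μ := ⟨by simpa [μ] using hfin⟩
  have hAm : ∀ n, MeasurableSet (A n) := fun n => (hA' n).1.measurableSet
  have htend : Tendsto (fun n => μ (accumulate A n)ᶜ) atTop (𝓝 (μ (⋃ n, A n)ᶜ)) := by
    have e : (⋃ n, A n)ᶜ = ⋂ n, (accumulate A n)ᶜ := by
      rw [← compl_iUnion, iUnion_accumulate]
    rw [e]
    refine tendsto_measure_iInter_atTop (fun n => ?_) ?_ ⟨0, measure_ne_top _ _⟩
    · exact (MeasurableSet.biUnion (to_countable _) fun i _ => hAm i).compl.nullMeasurableSet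
    · exact fun a b hab => compl_subset_compl.2 (monotone_accumulate hab)
  have hzero : μ (⋃ n, A n)ᶜ = 0 := by
    rw [Measure.restrict_apply (MeasurableSet.iUnion hAm).compl]
    refine measure_mono_null ?_ hcov
    rw [sUnion_range]
    exact fun x hx => ⟨hx.2.1, hx.1⟩
  rw [hzero] at htend
  have hη2 : 0 < η / 2 := ENNReal.half_pos hη
  obtain ⟨N, hN⟩ := ((tendsto_order.1 htend).2 _ hη2).exists
  have hδ : η / 2 / (N + 1 : ℕ) ≠ 0 := by
    refine (ENNReal.div_pos hη2.ne' (by simp)).ne'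
  have hinner : ∀ n, ∃ K ⊆ disjointed A n ∩ B, IsCompact K ∧
      μ ((disjointed A n ∩ B) \ K) < η / 2 / (N + 1 : ℕ) := fun n =>
    ((MeasurableSet.disjointed hAm n).inter hBm).exists_isCompact_sdiff_lt (measure_ne_top _ _) hδ
  choose K hK hKc hKμ using hinner
  refine ⟨N, fun i => K i, fun i => hKc i, fun i => (hK i).trans fun x hx => hx.2.1,
    fun i => (hA' i).2.mono fun x hx => disjointed_subset A _ (hK i hx).1, ?_, ?_⟩
  · intro i j hij
    exact (disjoint_disjointed A (fun e => hij (Fin.ext e))).mono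
      ((hK i).trans inter_subset_left) ((hK j).trans inter_subset_left)
  · have hsub : B \ (⋃ i : Fin (N + 1), K i) ⊆
        B ∩ ((accumulate A N)ᶜ ∪ ⋃ i : Fin (N + 1), (disjointed A i ∩ B) \ K i) := by
      rintro x ⟨hxB, hx⟩
      refine ⟨hxB, ?_⟩
      by_cases hxA : x ∈ accumulate A N
      · right
        rw [← partialSups_eq_accumulate, ← partialSups_disjointed, partialSups_eq_accumulate] at hxA
        obtain ⟨i, hi, hxi⟩ := mem_accumulate.1 hxA
        refine mem_iUnion.2 ⟨⟨i, by omega⟩, ⟨hxi, hxB⟩, fun hxK =>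
          hx (mem_iUnion.2 ⟨⟨i, by omega⟩, hxK⟩)⟩
      · exact Or.inl hxA
    calc μHE[m] (B \ (⋃ i : Fin (N + 1), K i))
        ≤ μ ((accumulate A N)ᶜ ∪ ⋃ i : Fin (N + 1), (disjointed A i ∩ B) \ K i) := by
          rw [Measure.restrict_apply', inter_comm]
          · exact measure_mono hsub
          · exact hBm
      _ ≤ η / 2 + ∑ i : Fin (N + 1), η / 2 / (N + 1 : ℕ) := by
          refine (measure_union_le _ _).trans (add_le_add hN.le ?_)
          refine (measure_iUnion_fintype_le _ _).trans (Finset.sum_le_sum fun i _ => (hKμ i).le)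
      _ = η := by
          rw [Finset.sum_const, Finset.card_univ, Fintype.card_fin, nsmul_eq_mul,
            ENNReal.mul_div_cancel (by simp) (by simp), ENNReal.add_halves]

end disjointify

end

noncomputable section

open scoped RealInnerProductSpace ENNReal
open Filter Topology

theorem ENNReal.le_of_forall_pos_le_add_mul {a b C : ℝ≥0∞} (hC : C ≠ ⊤)
    (h : ∀ ε : ℝ≥0, 0 < ε → a ≤ b + ε * C) : a ≤ b := by
  refine ENNReal.le_of_forall_pos_le_add fun δ hδ _ => ?_
  refine (h (δ / (C.toNNReal + 1)) (by positivity)).trans ?_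
  gcongr
  rw [← ENNReal.coe_toNNReal hC, ← ENNReal.coe_mul, ENNReal.coe_le_coe, ENNReal.toNNReal_coe]
  calc δ / (C.toNNReal + 1) * C.toNNReal ≤ δ / (C.toNNReal + 1) * (C.toNNReal + 1) := by
        gcongr; simp
    _ = δ := div_mul_cancel₀ _ (by positivity)

theorem norm_le_of_norm_sub_le {X E : Type*} [SeminormedAddCommGroup E] {W : X → E} {c : ℝ}
    (hW : ∀ x y, ‖W x - W y‖ ≤ c) (x y : X) : ‖W x‖ ≤ ‖W y‖ + c := by
  have := norm_le_norm_add_norm_sub (W y) (W x)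
  rw [norm_sub_rev] at this
  linarith [hW x y]

section
variable {m : ℕ}

theorem integrable_mul_fderiv {a : Euc (m + 1) → ℝ} (ha : Measurable a) {c : ℝ}
    (hac : ∀ x, ‖a x‖ ≤ c) {ζ : Euc (m + 1) → ℝ} (hζ : ContDiff ℝ 1 ζ)
    (hζc : HasCompactSupport ζ) (e : Euc (m + 1)) :
    Integrable fun x => a x * fderiv ℝ ζ x e :=
  ((((hζ.continuous_fderiv one_ne_zero).clm_apply continuous_const).integrable_of_hasCompactSupport
    (hζc.fderiv_apply ℝ e))).bdd_mul (c := c) ha.aestronglyMeasurable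
    (Eventually.of_forall hac)

theorem integrable_fderiv_apply {W : Euc (m + 1) → Euc (m + 1)} (hW : Measurable W) {c : ℝ}
    (hWc : ∀ x, ‖W x‖ ≤ c) {ζ : Euc (m + 1) → ℝ} (hζ : ContDiff ℝ 1 ζ)
    (hζc : HasCompactSupport ζ) :
    Integrable fun x => fderiv ℝ ζ x (W x) := by
  have h1 : Integrable fun x => ‖fderiv ℝ ζ x‖ * c :=
    (((hζ.continuous_fderiv one_ne_zero).integrable_of_hasCompactSupport
      (hζc.fderiv ℝ)).norm).mul_const c
  refine h1.mono' ?_ (Eventually.of_forall fun x => ?_)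
  · have h2 : Measurable fun x => fderiv ℝ ζ x (W x) :=
      (hζ.continuous_fderiv_apply one_ne_zero).measurable.comp (measurable_id.prodMk hW)
    exact h2.aestronglyMeasurable
  · exact ((fderiv ℝ ζ x).le_opNorm _).trans (by gcongr; exact hWc x)

variable {F : Set (Euc (m + 1))} {W : Euc (m + 1) → Euc (m + 1)} {c : ℝ} {ζ : Euc (m + 1) → ℝ}

theorem enorm_integral_fderiv_apply_le_of_isFlatSet (hF : IsClosed F)
    (hFfin : ∀ r, μHE[m] (F ∩ closedBall 0 r) < ⊤) (hW : Measurable W)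
    (hWc : ∀ x y, ‖W x - W y‖ ≤ c) (hloc : ∀ x ∉ F, ∀ᶠ y in 𝓝 x, W y = W x)
    (hζ : ContDiff ℝ 1 ζ) (hζc : HasCompactSupport ζ) {K : Set (Euc (m + 1))}
    (hK : MeasurableSet K) (hKF : K ⊆ F) {ε : ℝ} (hε : 0 < ε) (hflat : IsFlatSet ε K) :
    ‖∫ x, fderiv ℝ ζ x (W x)‖ₑ ≤ ENNReal.ofReal c * ∫⁻ x in F, ‖ζ x‖ₑ ∂μHE[m] +
      m * (ENNReal.ofReal c * (ENNReal.ofReal ε * 2 ^ m * ∫⁻ x in K, ‖ζ x‖ₑ ∂μHE[m] +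
        ∫⁻ x in F \ K, ‖ζ x‖ₑ ∂μHE[m])) := by
  obtain ⟨n, hn, hflat⟩ := hflat
  obtain ⟨T, hT⟩ := exists_frame_of_norm_eq_one hn
  set e : Fin (m + 1) → Euc (m + 1) := fun j => T (EuclideanSpace.single j 1) with he
  have he1 : ∀ j, ‖e j‖ = 1 := fun j => by simp [he]
  have heW : ∀ x, W x = ∑ j, ⟪e j, W x⟫ • e j := fun x => by
    set b := (EuclideanSpace.basisFun (Fin (m + 1)) ℝ).map T
    have hb : ∀ j, b j = e j := fun j => by simp [b, he]
    have := b.sum_repr' (W x)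
    simp only [hb] at this
    exact this.symm
  have ham : ∀ j, Measurable fun x => ⟪e j, W x⟫ := fun j => measurable_const.inner hW
  have hac : ∀ j x y, |⟪e j, W x⟫ - ⟪e j, W y⟫| ≤ c := fun j x y => by
    rw [← inner_sub_right]
    refine (abs_real_inner_le_norm _ _).trans ?_
    rw [he1, one_mul]; exact hWc x y
  have hloc' : ∀ j, ∀ x ∉ F, ∀ᶠ y in 𝓝 x, ⟪e j, W y⟫ = ⟪e j, W x⟫ := fun j x hx =>
    (hloc x hx).mono fun y hy => by rw [hy]
  have hint : ∀ j, Integrable fun x => ⟪e j, W x⟫ * fderiv ℝ ζ x (e j) := fun j =>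
    integrable_mul_fderiv (ham j)
      (fun x => norm_le_of_norm_sub_le (W := fun x => ⟪e j, W x⟫) (hac j) x 0) hζ hζc (e j)
  have hsum : ∫ x, fderiv ℝ ζ x (W x) = ∑ j, ∫ x, ⟪e j, W x⟫ * fderiv ℝ ζ x (e j) := by
    rw [← integral_finsetSum _ fun j _ => hint j]
    refine integral_congr_ae (Eventually.of_forall fun x => ?_)
    change fderiv ℝ ζ x (W x) = _
    conv_lhs => rw [heW x]
    simp
  rw [hsum, Fin.sum_univ_succ]
  refine (enorm_add_le _ _).trans (add_le_add ?_ ?_)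
  · exact enorm_integral_mul_fderiv_frameAxis_le_setLIntegral T hF hFfin (ham 0) (hac 0) (hloc' 0)
      hζ hζc
  · refine (enorm_sum_le _ _).trans ?_
    refine (Finset.sum_le_card_nsmul _ _ _ fun j _ => ?_).trans_eq
      (by rw [Finset.card_univ, Fintype.card_fin, nsmul_eq_mul])
    obtain ⟨T', hT'⟩ := exists_frame_of_norm_eq_one (he1 j.succ)
    rw [← hT']
    refine enorm_integral_mul_fderiv_frameAxis_le_of_subset T' hF hFfin
      (a := fun x => ⟪frameAxis T', W x⟫) ?_ ?_ ?_
      hζ hζc hK hKF fun S hS => volume_frameProj_image_le_of_flat T' hn ?_ hε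
        fun x hx y hy => hflat x (hS hx) y (hS hy)
    · rw [hT']; exact ham _
    · rw [hT']; exact hac _
    · rw [hT']; exact hloc' _
    · rw [hT', ← hT, frameAxis, he, T.inner_map_map]
      simp [EuclideanSpace.inner_single_left]

theorem enorm_integral_fderiv_apply_le (hF : IsClosed F)
    (hFfin : ∀ r, μHE[m] (F ∩ closedBall 0 r) < ⊤)
    (hrect : ∀ ε > 0, ∃ 𝒜 : Set (Set (Euc (m + 1))), 𝒜.Countable ∧
      (∀ A ∈ 𝒜, IsCompact A ∧ IsFlatSet ε A) ∧ μHE[m] (F \ ⋃₀ 𝒜) = 0)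
    (hW : Measurable W) (hWc : ∀ x y, ‖W x - W y‖ ≤ c)
    (hloc : ∀ x ∉ F, ∀ᶠ y in 𝓝 x, W y = W x)
    (hζ : ContDiff ℝ 1 ζ) (hζc : HasCompactSupport ζ) :
    ‖∫ x, fderiv ℝ ζ x (W x)‖ₑ ≤ ENNReal.ofReal c * ∫⁻ x in F, ‖ζ x‖ₑ ∂μHE[m] := by
  obtain ⟨R, hR⟩ := hζc.isCompact.isBounded.subset_closedBall 0
  obtain ⟨M, hM⟩ := hζ.continuous.bounded_above_of_compact_support hζc
  have hbd : ∀ D : Set (Euc (m + 1)), MeasurableSet D → ∫⁻ x in D, ‖ζ x‖ₑ ∂μHE[m] ≤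
      ENNReal.ofReal M * μHE[m] (D ∩ closedBall 0 R) := by
    intro D hD
    calc ∫⁻ x in D, ‖ζ x‖ₑ ∂μHE[m]
        ≤ ∫⁻ x in D, (closedBall 0 R).indicator (fun _ => ENNReal.ofReal M) x ∂μHE[m] := by
          refine lintegral_mono fun x => ?_
          by_cases hx : x ∈ closedBall (0 : Euc (m + 1)) R
          · rw [indicator_of_mem hx, ← ofReal_norm]
            exact ENNReal.ofReal_le_ofReal (hM x)
          · rw [indicator_of_notMem hx, image_eq_zero_of_notMem_tsupport fun h => hx (hR h)]
            simp
      _ = _ := by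
          rw [lintegral_indicator_const measurableSet_closedBall,
            Measure.restrict_apply measurableSet_closedBall, inter_comm]
  set I := ∫⁻ x in F, ‖ζ x‖ₑ ∂μHE[m] with hI
  have hIfin : I ≠ ⊤ :=
    ((hbd F hF.measurableSet).trans_lt (ENNReal.mul_lt_top ENNReal.ofReal_lt_top (hFfin R))).ne
  refine ENNReal.le_of_forall_pos_le_add_mul
    (C := m * (ENNReal.ofReal c * (2 ^ m * I + ENNReal.ofReal M))) ?_ fun ε hε => ?_
  · refine ENNReal.mul_ne_top (by simp) (ENNReal.mul_ne_top ENNReal.ofReal_ne_top ?_)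
    exact ENNReal.add_ne_top.2 ⟨ENNReal.mul_ne_top (by simp) hIfin, ENNReal.ofReal_ne_top⟩
  have hε' : (0 : ℝ) < ε := by exact_mod_cast hε
  obtain ⟨𝒜, h𝒜c, h𝒜, hcov⟩ := hrect ε hε'
  obtain ⟨N, K, hKc, hKF, hflat, hdisj, hη⟩ := exists_finite_disjoint_isFlatSet hF (hFfin R) h𝒜c
    h𝒜 hcov (η := ε) (by simpa using hε.ne')
  set V : Fin (N + 1) → Set (Euc (m + 1)) := fun k => (⋃ l ∈ ({k}ᶜ : Set (Fin (N + 1))), K l)ᶜ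
  have hVo : ∀ k, IsOpen (V k) := fun k =>
    (((Set.toFinite _).isClosed_biUnion fun l _ => (hKc l).isClosed)).isOpen_compl
  have hVcov : (univ : Set (Euc (m + 1))) ⊆ ⋃ k, V k := by
    intro x _
    by_cases hx : ∃ k, x ∈ K k
    · obtain ⟨k, hk⟩ := hx
      refine mem_iUnion.2 ⟨k, fun hmem => ?_⟩
      obtain ⟨l, hl, hxl⟩ := mem_iUnion₂.1 hmem
      exact disjoint_left.1 (hdisj (Ne.symm hl)) hk hxl
    · refine mem_iUnion.2 ⟨0, fun hmem => ?_⟩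
      obtain ⟨l, -, hxl⟩ := mem_iUnion₂.1 hmem
      exact hx ⟨l, hxl⟩
  obtain ⟨ρ, hρ⟩ := SmoothPartitionOfUnity.exists_isSubordinate
    (modelWithCornersSelf ℝ (Euc (m + 1))) isClosed_univ V hVo hVcov
  have hρ1 : ∀ x, ∑ k, ρ k x = 1 := fun x => by
    rw [← finsum_eq_sum_of_fintype]; exact ρ.sum_eq_one (mem_univ x)
  have hρs : ∀ k, ContDiff ℝ 1 (ρ k) := fun k => by
    have h1 : ContDiff ℝ (⊤ : ℕ∞) (ρ k) := (ρ k).contMDiff.contDiff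
    exact h1.of_le (by exact_mod_cast le_top)
  set ζk : Fin (N + 1) → Euc (m + 1) → ℝ := fun k x => ρ k x * ζ x with hζk
  have hζkd : ∀ k, ContDiff ℝ 1 (ζk k) := fun k => (hρs k).mul hζ
  have hζkc : ∀ k, HasCompactSupport (ζk k) := fun k => hζc.mul_left
  have hζsum : ζ = fun x => ∑ k, ζk k x := by
    ext x; simp only [hζk]; rw [← Finset.sum_mul, hρ1, one_mul]
  have hesum : ∀ x, ∑ k, ‖ζk k x‖ₑ = ‖ζ x‖ₑ := fun x => by
    simp only [hζk, enorm_mul]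
    rw [← Finset.sum_mul]
    have : ∑ k, ‖ρ k x‖ₑ = 1 := by
      have h1 : ∀ k, ‖ρ k x‖ₑ = ENNReal.ofReal (ρ k x) := fun k =>
        Real.enorm_eq_ofReal (ρ.nonneg k x)
      simp_rw [h1]
      rw [← ENNReal.ofReal_sum_of_nonneg fun k _ => ρ.nonneg k x, hρ1, ENNReal.ofReal_one]
    rw [this, one_mul]
  have hlsum : ∀ D : Set (Euc (m + 1)),
      ∑ k, ∫⁻ x in D, ‖ζk k x‖ₑ ∂μHE[m] = ∫⁻ x in D, ‖ζ x‖ₑ ∂μHE[m] := fun D => by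
    rw [← lintegral_finsetSum _ fun k _ => (hζkd k).continuous.measurable.enorm]
    simp_rw [hesum]
  have hvan : ∀ k l, l ≠ k → ∀ x ∈ K l, ζk k x = 0 := by
    intro k l hlk x hx
    have : ρ k x = 0 := by
      refine image_eq_zero_of_notMem_tsupport fun hmem => ?_
      exact hρ k hmem (mem_iUnion₂.2 ⟨l, hlk, hx⟩)
    simp [hζk, this]
  have hKm : ∀ k, MeasurableSet (K k) := fun k => (hKc k).measurableSet
  set U := ⋃ k, K k
  have hUm : MeasurableSet U := MeasurableSet.iUnion hKm
  have hdiff : ∀ k, ∫⁻ x in F \ K k, ‖ζk k x‖ₑ ∂μHE[m] = ∫⁻ x in F \ U, ‖ζk k x‖ₑ ∂μHE[m] := by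
    intro k
    rw [← lintegral_indicator (hF.measurableSet.diff (hKm k)),
      ← lintegral_indicator (hF.measurableSet.diff hUm)]
    congr 1
    ext x
    by_cases hx : x ∈ U
    · have hxU : x ∉ F \ U := fun h => h.2 hx
      rw [indicator_of_notMem hxU, indicator_apply_eq_zero]
      intro hxk
      obtain ⟨l, hl⟩ := mem_iUnion.1 hx
      have hlk : l ≠ k := fun h => hxk.2 (h ▸ hl)
      rw [hvan k l hlk x hl, enorm_zero]
    · have hxk : x ∉ K k := fun h => hx (mem_iUnion.2 ⟨k, h⟩)
      have hiff : x ∈ F \ K k ↔ x ∈ F \ U := ⟨fun h => ⟨h.1, hx⟩, fun h => ⟨h.1, hxk⟩⟩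
      by_cases h : x ∈ F \ U
      · rw [indicator_of_mem h, indicator_of_mem (hiff.2 h)]
      · rw [indicator_of_notMem h, indicator_of_notMem (mt hiff.1 h)]
  have hint : ∀ k, Integrable fun x => fderiv ℝ (ζk k) x (W x) := fun k =>
    integrable_fderiv_apply hW (norm_le_of_norm_sub_le hWc · 0) (hζkd k) (hζkc k)
  have hsplit : ∫ x, fderiv ℝ ζ x (W x) = ∑ k, ∫ x, fderiv ℝ (ζk k) x (W x) := by
    rw [← integral_finsetSum _ fun k _ => hint k]
    refine integral_congr_ae (Eventually.of_forall fun x => ?_)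
    change fderiv ℝ ζ x (W x) = _
    have h1 : fderiv ℝ ζ x = ∑ k, fderiv ℝ (ζk k) x := by
      conv_lhs => rw [hζsum]
      exact fderiv_fun_sum fun k _ => (hζkd k).differentiable one_ne_zero x
    rw [h1, _root_.sum_apply]
  rw [hsplit]
  calc ‖∑ k, ∫ x, fderiv ℝ (ζk k) x (W x)‖ₑ
      ≤ ∑ k, (ENNReal.ofReal c * ∫⁻ x in F, ‖ζk k x‖ₑ ∂μHE[m] +
      m * (ENNReal.ofReal c * (ENNReal.ofReal ε * 2 ^ m * ∫⁻ x in K k, ‖ζk k x‖ₑ ∂μHE[m] +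
        ∫⁻ x in F \ K k, ‖ζk k x‖ₑ ∂μHE[m]))) := by
        refine (enorm_sum_le _ _).trans (Finset.sum_le_sum fun k _ => ?_)
        exact enorm_integral_fderiv_apply_le_of_isFlatSet hF hFfin hW hWc hloc (hζkd k) (hζkc k)
          (hKm k) (hKF k) hε' (hflat k)
    _ ≤ ∑ k, (ENNReal.ofReal c * ∫⁻ x in F, ‖ζk k x‖ₑ ∂μHE[m] +
      m * (ENNReal.ofReal c * (ε * 2 ^ m * ∫⁻ x in F, ‖ζk k x‖ₑ ∂μHE[m] +
        ∫⁻ x in F \ U, ‖ζk k x‖ₑ ∂μHE[m]))) := by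
        refine Finset.sum_le_sum fun k _ => ?_
        rw [hdiff, ENNReal.ofReal_coe_nnreal]
        gcongr
        exact hKF k
    _ = ENNReal.ofReal c * I + m * (ENNReal.ofReal c * (ε * 2 ^ m * I +
          ∫⁻ x in F \ U, ‖ζ x‖ₑ ∂μHE[m])) := by
        rw [Finset.sum_add_distrib, ← Finset.mul_sum, ← Finset.mul_sum, ← Finset.mul_sum,
          Finset.sum_add_distrib, ← Finset.mul_sum, hlsum, hlsum]
    _ ≤ ENNReal.ofReal c * I + m * (ENNReal.ofReal c * (ε * 2 ^ m * I +
          ENNReal.ofReal M * ε)) := by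
        gcongr
        refine (hbd _ (hF.measurableSet.diff hUm)).trans ?_
        gcongr
        refine le_trans (measure_mono ?_) hη
        exact fun x hx => ⟨⟨hx.1.1, hx.2⟩, hx.1.2⟩
    _ = _ := by ring
end

end

noncomputable section

open scoped RealInnerProductSpace ENNReal
open Filter Topology

/-- The points `v 0, …, v (m + 1)` are the vertices of a regular simplex of edge length `c`,
centred at the origin. -/
structure IsCenteredSimplex {m : ℕ} (c : ℝ) (v : Fin (m + 2) → Euc (m + 1)) : Prop where
  pos : 0 < c
  sum_eq_zero : ∑ i, v i = 0
  norm_sub_eq : ∀ i j, i ≠ j → ‖v i - v j‖ = c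

/-- The points at which the linear function `⟪·, v i⟫` is the strict minimum of all `⟪·, v j⟫`. -/
def minCell {m : ℕ} (v : Fin (m + 2) → Euc (m + 1)) (i : Fin (m + 2)) : Set (Euc (m + 1)) :=
  {x | ∀ j, j ≠ i → ⟪x, v i⟫ < ⟪x, v j⟫}

/-- The points at which `⟪·, v i⟫` and `⟪·, v j⟫` agree and are minimal. -/
def minWall {m : ℕ} (v : Fin (m + 2) → Euc (m + 1)) (i j : Fin (m + 2)) : Set (Euc (m + 1)) :=
  {x | ⟪x, v i⟫ = ⟪x, v j⟫ ∧ ∀ k, ⟪x, v i⟫ ≤ ⟪x, v k⟫}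

section
variable {m : ℕ} {v : Fin (m + 2) → Euc (m + 1)} {c : ℝ}

theorem isOpen_minCell (i : Fin (m + 2)) : IsOpen (minCell v i) := by
  have : minCell v i = ⋂ j, {x | j ≠ i → ⟪x, v i⟫ < ⟪x, v j⟫} := by ext; simp [minCell]
  rw [this]
  refine isOpen_iInter_of_finite fun j => ?_
  by_cases h : j = i
  · simp [h]
  · simpa [h] using isOpen_lt (by fun_prop) (by fun_prop)

theorem isClosed_minWall (i j : Fin (m + 2)) : IsClosed (minWall v i j) := by
  have : minWall v i j = {x | ⟪x, v i⟫ = ⟪x, v j⟫} ∩ ⋂ k, {x | ⟪x, v i⟫ ≤ ⟪x, v k⟫} := by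
    ext; simp [minWall]
  rw [this]
  exact (isClosed_eq (by fun_prop) (by fun_prop)).inter
    (isClosed_iInter fun k => isClosed_le (by fun_prop) (by fun_prop))

theorem disjoint_minCell {i j : Fin (m + 2)} (hij : i ≠ j) :
    Disjoint (minCell v i) (minCell v j) :=
  disjoint_left.2 fun _ hi hj => lt_asymm (hi j hij.symm) (hj i hij)

theorem disjoint_minCell_minWall (i : Fin (m + 2)) {j k : Fin (m + 2)} (hjk : j ≠ k) :
    Disjoint (minCell v i) (minWall v j k) := by
  refine disjoint_left.2 fun x hi hw => ?_
  by_cases h : i = j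
  · subst h; exact (hi k hjk.symm).ne hw.1
  · exact (hi j (Ne.symm h)).not_ge (hw.2 i)

theorem exists_mem_minCell_or_minWall (x : Euc (m + 1)) :
    (∃ i, x ∈ minCell v i) ∨ ∃ i j, i ≠ j ∧ x ∈ minWall v i j := by
  obtain ⟨i, hi⟩ := Finite.exists_min fun k => ⟪x, v k⟫
  by_cases h : ∃ j, j ≠ i ∧ ⟪x, v j⟫ ≤ ⟪x, v i⟫
  · obtain ⟨j, hji, hj⟩ := h
    exact Or.inr ⟨i, j, hji.symm, le_antisymm (hi j) hj, hi⟩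
  · push Not at h
    exact Or.inl ⟨i, h⟩

namespace IsCenteredSimplex

theorem inner_eq (h : IsCenteredSimplex c v) (i j : Fin (m + 2)) :
    ⟪v i, v j⟫ = c ^ 2 / 2 * (if i = j then 1 else 0) - c ^ 2 / 2 / (m + 2) := by
  have hn : (0 : ℝ) < m + 2 := by positivity
  have hin : ∀ i j, ⟪v i, v j⟫ =
      (‖v i‖ ^ 2 + ‖v j‖ ^ 2 - c ^ 2 + c ^ 2 * if i = j then 1 else 0) / 2 := by
    intro i j
    split_ifs with hij
    · subst hij; rw [real_inner_self_eq_norm_sq]; ring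
    · have := norm_sub_sq_real (v i) (v j)
      rw [h.norm_sub_eq i j hij] at this
      linarith
  have hsum : ∀ i, (m + 2) * ‖v i‖ ^ 2 + ∑ j, ‖v j‖ ^ 2 - (m + 1) * c ^ 2 = 0 := by
    intro i
    have h0 : ∑ j, ⟪v i, v j⟫ = 0 := by rw [← inner_sum, h.sum_eq_zero, inner_zero_right]
    simp_rw [hin, ← Finset.sum_div, Finset.sum_add_distrib, Finset.sum_sub_distrib,
      Finset.sum_add_distrib, ← Finset.mul_sum] at h0
    simp at h0
    linarith
  have heq : ∀ i j, ‖v i‖ ^ 2 = ‖v j‖ ^ 2 := fun i j => by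
    have := hsum i
    have := hsum j
    exact mul_left_cancel₀ hn.ne' (by linarith)
  have hval : ∀ i, 2 * (m + 2) * ‖v i‖ ^ 2 = (m + 1) * c ^ 2 := fun i => by
    have h1 := hsum i
    rw [Finset.sum_congr rfl fun j _ => heq j i] at h1
    simp at h1
    linarith
  rw [hin]
  have h1 : ∀ i, ‖v i‖ ^ 2 = (m + 1) * c ^ 2 / (2 * (m + 2)) := fun i => by
    rw [eq_div_iff (by positivity), ← hval i]; ring
  rw [h1, h1]
  field_simp
  ring

theorem norm_sq_eq (h : IsCenteredSimplex c v) (i : Fin (m + 2)) :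
    ‖v i‖ ^ 2 = c ^ 2 / 2 - c ^ 2 / 2 / (m + 2) := by
  rw [← real_inner_self_eq_norm_sq, h.inner_eq]; simp

theorem norm_pos (h : IsCenteredSimplex c v) (i : Fin (m + 2)) : 0 < ‖v i‖ := by
  refine (norm_nonneg _).lt_of_ne' fun h0 => ?_
  have h1 : 0 < ‖v i‖ ^ 2 := by
    rw [h.norm_sq_eq, sub_pos]
    have := h.pos
    refine div_lt_self (by positivity) ?_
    have : (0 : ℝ) ≤ m := by positivity
    linarith
  simp [h0] at h1

theorem span_eq_top (h : IsCenteredSimplex c v) : Submodule.span ℝ (range v) = ⊤ := by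
  have hli : LinearIndependent ℝ fun i : Fin (m + 1) => v i.succ := by
    rw [Fintype.linearIndependent_iff]
    intro g hg i
    have hc := h.pos
    have h0 : ⟪∑ i, g i • v i.succ, v 0⟫ = 0 := by rw [hg, inner_zero_left]
    have h1 : ⟪∑ i, g i • v i.succ, v i.succ⟫ = 0 := by rw [hg, inner_zero_left]
    simp only [sum_inner, real_inner_smul_left, h.inner_eq] at h0 h1
    simp [mul_sub, Finset.sum_sub_distrib, Fin.succ_ne_zero] at h0 h1
    rw [h0] at h1
    simpa [hc.ne'] using h1
  have := hli.span_eq_top_of_card_eq_finrank (by simp)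
  refine top_unique (this ▸ Submodule.span_mono ?_)
  rintro _ ⟨i, rfl⟩
  exact ⟨_, rfl⟩

theorem sum_inner_smul (h : IsCenteredSimplex c v) (x : Euc (m + 1)) :
    ∑ i, ⟪x, v i⟫ • v i = (c ^ 2 / 2) • x := by
  have hx : x ∈ Submodule.span ℝ (range v) := h.span_eq_top ▸ Submodule.mem_top
  induction hx using Submodule.span_induction with
  | mem x hx =>
    obtain ⟨j, rfl⟩ := hx
    simp_rw [h.inner_eq, sub_smul, Finset.sum_sub_distrib, ← Finset.smul_sum, h.sum_eq_zero]
    simp [ite_smul]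
  | zero => simp
  | add x y _ _ hx hy =>
    simp_rw [inner_add_left, add_smul, Finset.sum_add_distrib, hx, hy, smul_add]
  | smul a x _ hx =>
    simp_rw [real_inner_smul_left, mul_smul, ← Finset.smul_sum, hx]
    rw [smul_comm]

theorem coneOver_simplexSkeleton (h : IsCenteredSimplex c v) (hm : m ≠ 0) :
    coneOver (simplexSkeleton (m + 1) v) = {x | ∃ i j, i ≠ j ∧ x ∈ minWall v i j} := by
  have hc := h.pos
  ext y
  simp only [coneOver, simplexSkeleton, mem_ofPred_eq, mem_iUnion, Nat.add_sub_cancel]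
  constructor
  · rintro ⟨t, ht, x, ⟨A, hA, hx⟩, rfl⟩
    have hAc : Aᶜ.card = 2 := by rw [Finset.card_compl, Fintype.card_fin, hA]; omega
    obtain ⟨i, j, hij, hAij⟩ := Finset.card_eq_two.1 hAc
    have hi : i ∉ A := by rw [← Finset.mem_compl, hAij]; simp
    have hj : j ∉ A := by rw [← Finset.mem_compl, hAij]; simp
    refine ⟨i, j, hij, ?_⟩
    have hconv : Convex ℝ (minWall v i j) := by
      intro x hx y hy a b ha hb _
      refine ⟨?_, fun k => ?_⟩ <;>
        simp only [inner_add_left, real_inner_smul_left]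
      · rw [hx.1, hy.1]
      · exact add_le_add (mul_le_mul_of_nonneg_left (hx.2 k) ha)
          (mul_le_mul_of_nonneg_left (hy.2 k) hb)
    have hxw : x ∈ minWall v i j := by
      refine convexHull_min ?_ hconv hx
      rintro _ ⟨l, hl, rfl⟩
      have hli : l ≠ i := fun h => hi (h ▸ hl)
      have hlj : l ≠ j := fun h => hj (h ▸ hl)
      refine ⟨by simp [h.inner_eq, hli, hlj], fun k => ?_⟩
      rw [h.inner_eq, h.inner_eq, if_neg hli]
      gcongr
      split_ifs <;> norm_num
    refine ⟨?_, fun k => ?_⟩ <;> simp only [real_inner_smul_left]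
    · rw [hxw.1]
    · exact mul_le_mul_of_nonneg_left (hxw.2 k) ht
  · rintro ⟨i, j, hij, hy⟩
    set A : Finset (Fin (m + 2)) := {i, j}ᶜ with hA
    have hAc : A.card = m := by
      rw [hA, Finset.card_compl, Finset.card_pair hij, Fintype.card_fin]; omega
    set a : Fin (m + 2) → ℝ := fun k => ⟪y, v k⟫ - ⟪y, v i⟫ with ha
    have ha0 : ∀ k, 0 ≤ a k := fun k => sub_nonneg.2 (hy.2 k)
    have haA : ∀ k ∉ A, a k = 0 := by
      intro k hk
      simp only [hA, Finset.mem_compl, not_not, Finset.mem_insert, Finset.mem_singleton] at hk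
      rcases hk with rfl | rfl
      · simp [ha]
      · simp [ha, hy.1]
    have hsum : (c ^ 2 / 2) • y = ∑ k ∈ A, a k • v k := by
      rw [Finset.sum_subset (Finset.subset_univ A) fun k _ hk => by rw [haA k hk, zero_smul]]
      simp_rw [ha, sub_smul, Finset.sum_sub_distrib, ← Finset.smul_sum, h.sum_eq_zero,
        h.sum_inner_smul]
      simp
    have hκ : c ^ 2 / 2 ≠ 0 := by positivity
    by_cases hS : ∑ k ∈ A, a k = 0
    · have hz := (Finset.sum_eq_zero_iff_of_nonneg fun k _ => ha0 k).1 hS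
      rw [Finset.sum_eq_zero fun k hk => by rw [hz k hk, zero_smul]] at hsum
      have hy0 : y = 0 := (smul_eq_zero.1 hsum).resolve_left hκ
      obtain ⟨k, hk⟩ := Finset.card_pos.1 (hAc.symm ▸ Nat.pos_of_ne_zero hm)
      exact ⟨0, le_rfl, v k, ⟨A, hAc, subset_convexHull ℝ _ ⟨k, hk, rfl⟩⟩, by rw [hy0, zero_smul]⟩
    · have hSp : 0 < ∑ k ∈ A, a k := (Finset.sum_nonneg fun k _ => ha0 k).lt_of_ne' hS
      refine ⟨(∑ k ∈ A, a k) / (c ^ 2 / 2), by positivity, A.centerMass a v, ⟨A, hAc, ?_⟩, ?_⟩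
      · exact Finset.centerMass_mem_convexHull A (fun k _ => ha0 k) hSp
          fun k hk => ⟨k, hk, rfl⟩
      · rw [Finset.centerMass, ← hsum, smul_smul, smul_smul]
        rw [div_mul_eq_mul_div, mul_inv_cancel₀ hS, one_div_mul_cancel hκ, one_smul]

end IsCenteredSimplex
end

end

noncomputable section

open scoped RealInnerProductSpace ENNReal
open Filter Topology

section
variable {m : ℕ} (T : Euc (m + 1) ≃ₗᵢ[ℝ] Euc (m + 1))

theorem continuous_frameProj : Continuous (frameProj T) := (lipschitzWith_frameProj T).continuous

theorem hasDerivAt_framePoint (z : Euc m) (t : ℝ) :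
    HasDerivAt (fun t => framePoint T z t) (frameAxis T) t := by
  have : (fun t => framePoint T z t) = fun t : ℝ => framePoint T z 0 + t • frameAxis T := by
    ext1 t; exact framePoint_eq_add T z t
  rw [this]
  simpa using ((hasDerivAt_id t).smul_const (frameAxis T)).const_add (framePoint T z 0)

variable {ζ : Euc (m + 1) → ℝ} {τ : Euc m → ℝ}

theorem HasCompactSupport.comp_framePoint (hζc : HasCompactSupport ζ) :
    HasCompactSupport fun z => ζ (framePoint T z (τ z)) := by
  refine HasCompactSupport.intro (hζc.isCompact.image (continuous_frameProj T)) fun z hz => ?_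
  refine image_eq_zero_of_notMem_tsupport fun h => hz ⟨_, h, by simp⟩

theorem setIntegral_fderiv_frameAxis_subgraph (hτ : Continuous τ) (hζ : ContDiff ℝ 1 ζ)
    (hζc : HasCompactSupport ζ) :
    ∫ x in {x | ⟪frameAxis T, x⟫ < τ (frameProj T x)}, fderiv ℝ ζ x (frameAxis T) =
      ∫ z, ζ (framePoint T z (τ z)) := by
  set A := {x | ⟪frameAxis T, x⟫ < τ (frameProj T x)} with hA
  have hAm : MeasurableSet A :=
    (isOpen_lt (by fun_prop) (hτ.comp (continuous_frameProj T))).measurableSet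
  have hDc : Continuous fun x => fderiv ℝ ζ x (frameAxis T) :=
    (hζ.continuous_fderiv one_ne_zero).clm_apply continuous_const
  have hint : Integrable (A.indicator fun x => fderiv ℝ ζ x (frameAxis T)) :=
    (hDc.integrable_of_hasCompactSupport (hζc.fderiv_apply ℝ (frameAxis T))).indicator hAm
  have hmp := measurePreserving_framePoint T
  rw [← integral_indicator hAm]
  set h := A.indicator fun x => fderiv ℝ ζ x (frameAxis T)
  have e1 : ∫ x, h x = ∫ p : Euc m × ℝ, h (framePoint T p.1 p.2) ∂(volume.prod volume) := by
    rw [← hmp.map_eq] at hint ⊢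
    exact integral_map hmp.measurable.aemeasurable hint.aestronglyMeasurable
  have hint' : Integrable (fun p : Euc m × ℝ => h (framePoint T p.1 p.2))
      (volume.prod volume) := hmp.integrable_comp_of_integrable hint
  rw [e1, integral_prod _ hint']
  refine integral_congr_ae (Eventually.of_forall fun z => ?_)
  change ∫ t, h (framePoint T z t) = _
  have e2 : (fun t => h (framePoint T z t)) =
      (Iio (τ z)).indicator (deriv fun t => ζ (framePoint T z t)) := by
    ext t
    have hd : deriv (fun t => ζ (framePoint T z t)) t =
        fderiv ℝ ζ (framePoint T z t) (frameAxis T) :=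
      (((hζ.differentiable one_ne_zero _).hasFDerivAt).comp_hasDerivAt t
        (hasDerivAt_framePoint T z t)).deriv
    have hiff : framePoint T z t ∈ A ↔ t ∈ Iio (τ z) := by simp [hA]
    by_cases ht : t ∈ Iio (τ z)
    · rw [indicator_of_mem ht, hd]; exact indicator_of_mem (hiff.2 ht) _
    · rw [indicator_of_notMem ht]; exact indicator_of_notMem (mt hiff.1 ht) _
  rw [e2, integral_indicator measurableSet_Iio, ← integral_Iic_eq_integral_Iio]
  have hfs : ContDiff ℝ 1 fun t => framePoint T z t := by
    have : (fun t => framePoint T z t) = fun t : ℝ => framePoint T z 0 + t • frameAxis T := by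
      ext1 t; exact framePoint_eq_add T z t
    rw [this]; fun_prop
  refine HasCompactSupport.integral_Iic_deriv_eq (hζ.comp hfs) ?_ _
  refine HasCompactSupport.intro (hζc.isCompact.image (f := fun x => ⟪frameAxis T, x⟫)
    (by fun_prop)) fun t ht => ?_
  refine image_eq_zero_of_notMem_tsupport (f := ζ) fun hm => ht ⟨_, hm, by simp⟩

theorem MeasureTheory.Measure.restrict_iUnion_le_of_forall {α ι : Type*} [MeasurableSpace α]
    [Countable ι] [Nonempty ι] {μ ν : Measure α} {S : ι → Set α}
    (hS : ∀ i, MeasurableSet (S i)) (h : ∀ i, ∀ A ⊆ S i, MeasurableSet A → μ A ≤ ν A) :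
    μ.restrict (⋃ i, S i) ≤ ν := by
  obtain ⟨f, hf⟩ := exists_surjective_nat ι
  rw [← hf.iUnion_comp]
  refine Measure.le_iff.2 fun A hA => ?_
  have hD : ∀ i, MeasurableSet (disjointed (fun n => S (f n)) i) :=
    fun i => MeasurableSet.disjointed (fun n => hS (f n)) i
  have hdis : Pairwise (Function.onFun Disjoint fun i => A ∩ disjointed (fun n => S (f n)) i) :=
    fun i j hij =>
    (disjoint_disjointed (fun n => S (f n)) hij).mono inter_subset_right inter_subset_right
  rw [Measure.restrict_apply hA, ← iUnion_disjointed, inter_iUnion,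
    measure_iUnion hdis fun i => hA.inter (hD i)]
  calc ∑' i, μ (A ∩ disjointed (fun n => S (f n)) i)
      ≤ ∑' i, ν (A ∩ disjointed (fun n => S (f n)) i) := by
        refine ENNReal.tsum_le_tsum fun i => h (f i) _ ?_ (hA.inter (hD i))
        exact inter_subset_right.trans (disjointed_subset _ i)
    _ = ν (⋃ i, A ∩ disjointed (fun n => S (f n)) i) :=
        (measure_iUnion hdis fun i => hA.inter (hD i)).symm
    _ ≤ ν A := measure_mono (iUnion_subset fun i => inter_subset_left)

namespace IsCenteredSimplex
variable {v : Fin (m + 2) → Euc (m + 1)} {c : ℝ}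

theorem lintegral_minWall_le (h : IsCenteredSimplex c v) (hζ : ContDiff ℝ 1 ζ)
    (hζc : HasCompactSupport ζ) (hζ0 : ∀ x, 0 ≤ ζ x) (i : Fin (m + 2)) :
    0 ≤ ∫ x in minCell v i, fderiv ℝ ζ x (v i) ∧
    ENNReal.ofReal c * ∫⁻ x in ⋃ j : {j // j ≠ i}, minWall v i j, ‖ζ x‖ₑ ∂μHE[m] ≤
      2 * ENNReal.ofReal (∫ x in minCell v i, fderiv ℝ ζ x (v i)) := by
  have hc := h.pos
  set ρ := ‖v i‖ with hρ
  have hρ0 : 0 < ρ := h.norm_pos i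
  obtain ⟨T, hT⟩ := exists_frame_of_norm_eq_one (e := ρ⁻¹ • v i) (by
    rw [norm_smul, norm_inv, Real.norm_eq_abs, abs_of_pos hρ0, ← hρ, inv_mul_cancel₀ hρ0.ne'])
  have hvi : v i = ρ • frameAxis T := by rw [hT, smul_smul, mul_inv_cancel₀ hρ0.ne', one_smul]
  have hne : (Finset.univ.erase i).Nonempty :=
    Finset.card_pos.1 (by rw [Finset.card_erase_of_mem (Finset.mem_univ i)]; simp)
  set κ := c ^ 2 / 2 with hκ
  have hκ0 : 0 < κ := by positivity
  have hdiff : ∀ j, j ≠ i → ⟪v i, v i⟫ - ⟪v i, v j⟫ = κ := fun j hj => by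
    rw [h.inner_eq, h.inner_eq, if_pos rfl, if_neg hj.symm]; ring
  set τ : Euc m → ℝ := fun z => (Finset.univ.erase i).inf' hne
    fun j => ρ / κ * ⟪framePoint T z 0, v j⟫ with hτ
  have hf0 : Continuous fun z => framePoint T z 0 :=
    (continuous_framePoint T).comp (continuous_id.prodMk continuous_const)
  have hτc : Continuous τ := Continuous.finset_inf'_apply hne fun j _ =>
    continuous_const.mul (hf0.inner continuous_const)
  have hperp : ∀ z, ⟪framePoint T z 0, v i⟫ = 0 := fun z => by
    rw [hvi, real_inner_smul_right, real_inner_comm, inner_frameAxis_framePoint, mul_zero]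
  have hsub : ∀ z t j, j ≠ i → ⟪framePoint T z t, v j⟫ - ⟪framePoint T z t, v i⟫ =
      κ / ρ * (ρ / κ * ⟪framePoint T z 0, v j⟫ - t) := fun z t j hj => by
    rw [framePoint_eq_add, inner_add_left, inner_add_left, hperp, real_inner_smul_left,
      real_inner_smul_left]
    have h1 : ⟪frameAxis T, v i⟫ - ⟪frameAxis T, v j⟫ = ρ⁻¹ * κ := by
      rw [hT, real_inner_smul_left, real_inner_smul_left, ← mul_sub, hdiff j hj]
    have h2 : κ / ρ * (ρ / κ * ⟪framePoint T z 0, v j⟫ - t) =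
        ⟪framePoint T z 0, v j⟫ - t * (ρ⁻¹ * κ) := by field_simp
    rw [h2, ← h1]; ring
  have hκρ : 0 < κ / ρ := by positivity
  have hcell : minCell v i = {x | ⟪frameAxis T, x⟫ < τ (frameProj T x)} := by
    ext x
    rw [mem_ofPred_eq, hτ, Finset.lt_inf'_iff]
    refine forall_congr' fun j => ?_
    simp only [Finset.mem_erase, Finset.mem_univ, and_true]
    refine forall_congr' fun hj => ?_
    rw [← sub_pos, ← framePoint_frameProj T x, hsub _ _ _ hj, framePoint_frameProj,
      mul_pos_iff_of_pos_left hκρ, sub_pos]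
  set g : Euc m → Euc (m + 1) := fun z => framePoint T z (τ z) with hg
  have hgc : Continuous g := (continuous_framePoint T).comp (continuous_id.prodMk hτc)
  have hwall : ∀ j, j ≠ i → ∀ x ∈ minWall v i j, g (frameProj T x) = x := by
    intro j hj x hx
    have : τ (frameProj T x) = ⟪frameAxis T, x⟫ := by
      have key : ∀ k, k ≠ i → ⟪x, v k⟫ - ⟪x, v i⟫ =
          κ / ρ * (ρ / κ * ⟪framePoint T (frameProj T x) 0, v k⟫ - ⟪frameAxis T, x⟫) :=
        fun k hk => by rw [← hsub _ _ _ hk, framePoint_frameProj]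
      refine le_antisymm ?_ ?_
      · refine (Finset.inf'_le _ (Finset.mem_erase.2 ⟨hj, Finset.mem_univ j⟩)).trans ?_
        have := key j hj
        rw [hx.1, sub_self, zero_eq_mul, or_iff_right hκρ.ne'] at this
        linarith
      · refine Finset.le_inf' _ _ fun k hk => ?_
        have h1 := key k (Finset.ne_of_mem_erase hk)
        have h2 := sub_nonneg.2 (hx.2 k)
        rw [h1, mul_nonneg_iff_of_pos_left hκρ] at h2
        linarith
    rw [hg]
    simp only
    rw [this, framePoint_frameProj]
  have hmeas : (μHE[m]).restrict (⋃ j : {j // j ≠ i}, minWall v i j) ≤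
      ENNReal.ofReal (c / (2 * ρ))⁻¹ • Measure.map g volume := by
    have hnonempty : Nonempty {j // j ≠ i} := ⟨⟨hne.choose, Finset.ne_of_mem_erase hne.choose_spec⟩⟩
    refine Measure.restrict_iUnion_le_of_forall (fun j => (isClosed_minWall i j).measurableSet)
      fun j A hA hAm => ?_
    have hij : i ≠ j := j.2.symm
    rw [Measure.smul_apply, smul_eq_mul, Measure.map_apply hgc.measurable hAm]
    refine (euclideanHausdorffMeasure_le_volume_frameProj_image T (n := c⁻¹ • (v i - v j))
      (q := c / (2 * ρ)) ?_ (by positivity) ?_ ?_).trans ?_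
    · rw [norm_smul, h.norm_sub_eq _ _ hij, norm_inv, Real.norm_eq_abs, abs_of_pos hc,
        inv_mul_cancel₀ hc.ne']
    · rw [hT, real_inner_smul_left, real_inner_smul_right, inner_sub_right, hdiff j j.2, hκ]
      field_simp
    · intro x hx
      rw [real_inner_smul_left, real_inner_comm, inner_sub_right, (hA hx).1, sub_self, mul_zero]
    · gcongr
      rintro _ ⟨x, hx, rfl⟩
      rw [mem_preimage, hwall j j.2 x (hA hx)]
      exact hx
  have hint : ∫ x in minCell v i, fderiv ℝ ζ x (v i) = ρ * ∫ z, ζ (g z) := by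
    rw [← setIntegral_fderiv_frameAxis_subgraph T hτc hζ hζc, ← hcell, ← integral_const_mul]
    refine integral_congr_ae (Eventually.of_forall fun x => ?_)
    change fderiv ℝ ζ x (v i) = ρ * fderiv ℝ ζ x (frameAxis T)
    rw [hvi, map_smul, smul_eq_mul]
  have hζg : Integrable fun z => ζ (g z) :=
    (hζ.continuous.comp hgc).integrable_of_hasCompactSupport (hζc.comp_framePoint T)
  refine ⟨hint ▸ mul_nonneg hρ0.le (integral_nonneg fun z => hζ0 _), ?_⟩
  rw [hint, ENNReal.ofReal_mul hρ0.le,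
    ofReal_integral_eq_lintegral_ofReal hζg (Eventually.of_forall fun z => hζ0 _)]
  calc ENNReal.ofReal c * ∫⁻ x in ⋃ j : {j // j ≠ i}, minWall v i j, ‖ζ x‖ₑ ∂μHE[m]
      ≤ ENNReal.ofReal c *
          ∫⁻ x, ‖ζ x‖ₑ ∂(ENNReal.ofReal (c / (2 * ρ))⁻¹ • Measure.map g volume) := by
        gcongr
    _ = ENNReal.ofReal c * (ENNReal.ofReal (c / (2 * ρ))⁻¹ * ∫⁻ z, ‖ζ (g z)‖ₑ) := by
        rw [lintegral_smul_measure, lintegral_map hζ.continuous.measurable.enorm hgc.measurable]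
        rfl
    _ = 2 * (ENNReal.ofReal ρ * ∫⁻ z, ENNReal.ofReal (ζ (g z))) := by
        simp_rw [fun z => Real.enorm_eq_ofReal (hζ0 (g z))]
        rw [← mul_assoc, ← mul_assoc, ← ENNReal.ofReal_mul hc.le]
        congr 1
        rw [← ENNReal.ofReal_ofNat 2, ← ENNReal.ofReal_mul zero_le_two]
        congr 1
        field_simp

theorem lintegral_iUnion_minWall_le (h : IsCenteredSimplex c v) (hζ : ContDiff ℝ 1 ζ)
    (hζc : HasCompactSupport ζ) (hζ0 : ∀ x, 0 ≤ ζ x) :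
    ENNReal.ofReal c * ∫⁻ x in {x | ∃ i j, i ≠ j ∧ x ∈ minWall v i j}, ‖ζ x‖ₑ ∂μHE[m] ≤
      ENNReal.ofReal (∑ i, ∫ x in minCell v i, fderiv ℝ ζ x (v i)) := by
  set E := {x | ∃ i j, i ≠ j ∧ x ∈ minWall v i j} with hE
  set G : Fin (m + 2) → Set (Euc (m + 1)) := fun i => ⋃ j : {j // j ≠ i}, minWall v i j with hG
  have hGm : ∀ i, MeasurableSet (G i) := fun i =>
    MeasurableSet.iUnion fun j => (isClosed_minWall i j).measurableSet
  have hEG : E = ⋃ i, G i := by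
    ext x
    simp only [hE, hG, mem_iUnion, mem_ofPred_eq, Subtype.exists, exists_prop]
    exact exists_congr fun i => exists_congr fun j => by rw [ne_comm]
  have hEm : MeasurableSet E := hEG ▸ MeasurableSet.iUnion hGm
  have hm : ∀ i, Measurable ((G i).indicator fun x => ‖ζ x‖ₑ) := fun i =>
    hζ.continuous.measurable.enorm.indicator (hGm i)
  have hpt : ∀ x, 2 * E.indicator (fun x => ‖ζ x‖ₑ) x ≤
      ∑ i, (G i).indicator (fun x => ‖ζ x‖ₑ) x := by
    intro x
    by_cases hx : x ∈ E
    · obtain ⟨i, j, hij, hw⟩ := hx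
      have hi : x ∈ G i := mem_iUnion.2 ⟨⟨j, hij.symm⟩, hw⟩
      have hj : x ∈ G j := mem_iUnion.2 ⟨⟨i, hij⟩, hw.1.symm, fun k => hw.1 ▸ hw.2 k⟩
      have hxE : x ∈ E := ⟨i, j, hij, hw⟩
      calc 2 * E.indicator (fun x => ‖ζ x‖ₑ) x
          = ∑ k ∈ {i, j}, (G k).indicator (fun x => ‖ζ x‖ₑ) x := by
            rw [Finset.sum_pair hij, indicator_of_mem hi, indicator_of_mem hj,
              indicator_of_mem hxE, two_mul]
        _ ≤ _ := Finset.sum_le_univ_sum_of_nonneg fun k => zero_le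
    · rw [indicator_of_notMem hx, mul_zero]; exact zero_le
  have h2 : 2 * (ENNReal.ofReal c * ∫⁻ x in E, ‖ζ x‖ₑ ∂μHE[m]) ≤
      2 * ENNReal.ofReal (∑ i, ∫ x in minCell v i, fderiv ℝ ζ x (v i)) := by
    calc 2 * (ENNReal.ofReal c * ∫⁻ x in E, ‖ζ x‖ₑ ∂μHE[m])
        = ENNReal.ofReal c * ∫⁻ x, 2 * E.indicator (fun x => ‖ζ x‖ₑ) x ∂μHE[m] := by
          rw [lintegral_const_mul' _ _ (by simp), lintegral_indicator hEm]; ring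
      _ ≤ ENNReal.ofReal c * ∫⁻ x, ∑ i, (G i).indicator (fun x => ‖ζ x‖ₑ) x ∂μHE[m] := by
          gcongr with x; exact hpt x
      _ = ∑ i, ENNReal.ofReal c * ∫⁻ x in G i, ‖ζ x‖ₑ ∂μHE[m] := by
          rw [lintegral_finsetSum _ fun i _ => hm i, Finset.mul_sum]
          simp_rw [fun i => lintegral_indicator (μ := μHE[m]) (hGm i) fun x => ‖ζ x‖ₑ]
      _ ≤ ∑ i, 2 * ENNReal.ofReal (∫ x in minCell v i, fderiv ℝ ζ x (v i)) :=
          Finset.sum_le_sum fun i _ => (h.lintegral_minWall_le hζ hζc hζ0 i).2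
      _ = _ := by
          rw [← Finset.mul_sum, ENNReal.ofReal_sum_of_nonneg fun i _ =>
            (h.lintegral_minWall_le hζ hζc hζ0 i).1]
  exact (ENNReal.mul_le_mul_iff_right two_ne_zero (by simp)).1 h2

end IsCenteredSimplex
end

end

noncomputable section

open scoped RealInnerProductSpace ENNReal
open Filter Topology

section
variable {m : ℕ}

theorem isometry_framePoint_zero (T : Euc (m + 1) ≃ₗᵢ[ℝ] Euc (m + 1)) :
    Isometry fun z => framePoint T z 0 := by
  refine Isometry.of_dist_eq fun z w => ?_
  rw [dist_eq_norm, dist_eq_norm, ← sq_eq_sq₀ (norm_nonneg _) (norm_nonneg _), norm_sq_eq_frame T]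
  simp [inner_sub_right]

theorem framePoint_frameProj_of_inner_eq_zero {T : Euc (m + 1) ≃ₗᵢ[ℝ] Euc (m + 1)}
    {x : Euc (m + 1)} (hx : ⟪frameAxis T, x⟫ = 0) : framePoint T (frameProj T x) 0 = x := by
  conv_rhs => rw [← framePoint_frameProj T x, hx]

theorem euclideanHausdorffMeasure_lt_top_of_subset_hyperplane {n : Euc (m + 1)} (hn : ‖n‖ = 1)
    {s : Set (Euc (m + 1))} (hs : ∀ x ∈ s, ⟪n, x⟫ = 0) (hb : Bornology.IsBounded s) :
    μHE[m] s < ⊤ := by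
  obtain ⟨T, hT⟩ := exists_frame_of_norm_eq_one hn
  refine (euclideanHausdorffMeasure_le_volume_frameProj_image T hn one_pos ?_ hs).trans_lt ?_
  · rw [hT, real_inner_self_eq_norm_sq, hn, one_pow]
  · exact ENNReal.mul_lt_top ENNReal.ofReal_lt_top
      ((lipschitzWith_frameProj T).isBounded_image hb).measure_lt_top

theorem volume_hyperplane {n : Euc (m + 1)} (hn : ‖n‖ = 1) :
    volume {x : Euc (m + 1) | ⟪n, x⟫ = 0} = 0 := by
  have h := Measure.addHaar_submodule (volume : Measure (Euc (m + 1)))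
    (LinearMap.ker (innerSL ℝ n : Euc (m + 1) →ₗ[ℝ] ℝ)) ?_
  · convert h using 2
    ext x; simp
  · intro htop
    have : n ∈ LinearMap.ker (innerSL ℝ n : Euc (m + 1) →ₗ[ℝ] ℝ) := htop ▸ Submodule.mem_top
    simp at this
    simp [this] at hn

/-- The points at which the minimum of the functions `⟪·, v i⟫` is attained at least twice. -/
def minWalls (v : Fin (m + 2) → Euc (m + 1)) : Set (Euc (m + 1)) :=
  {x | ∃ i j, i ≠ j ∧ x ∈ minWall v i j}

variable {v : Fin (m + 2) → Euc (m + 1)} {c : ℝ}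

theorem minWalls_eq_iUnion :
    minWalls v = ⋃ p : {p : Fin (m + 2) × Fin (m + 2) // p.1 ≠ p.2}, minWall v p.1.1 p.1.2 := by
  ext x
  simp [minWalls]

theorem isClosed_minWalls : IsClosed (minWalls v) := by
  rw [minWalls_eq_iUnion]
  exact isClosed_iUnion_of_finite fun p => isClosed_minWall _ _

namespace IsCenteredSimplex

theorem norm_inv_smul_sub (h : IsCenteredSimplex c v) {i j : Fin (m + 2)} (hij : i ≠ j) :
    ‖c⁻¹ • (v i - v j)‖ = 1 := by
  rw [norm_smul, h.norm_sub_eq _ _ hij, norm_inv, Real.norm_eq_abs, abs_of_pos h.pos,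
    inv_mul_cancel₀ h.pos.ne']

theorem _root_.inner_smul_sub_eq_zero_of_mem_minWall {i j : Fin (m + 2)} {x : Euc (m + 1)}
    (hx : x ∈ minWall v i j) : ⟪c⁻¹ • (v i - v j), x⟫ = 0 := by
  rw [real_inner_smul_left, real_inner_comm, inner_sub_right, hx.1, sub_self, mul_zero]

theorem euclideanHausdorffMeasure_minWalls_inter_lt_top (h : IsCenteredSimplex c v)
    {s : Set (Euc (m + 1))} (hs : Bornology.IsBounded s) : μHE[m] (minWalls v ∩ s) < ⊤ := by
  rw [minWalls_eq_iUnion, iUnion_inter]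
  refine (measure_iUnion_le _).trans_lt ?_
  rw [tsum_fintype, ENNReal.sum_lt_top]
  intro p _
  exact euclideanHausdorffMeasure_lt_top_of_subset_hyperplane (h.norm_inv_smul_sub p.2)
    (fun x hx => inner_smul_sub_eq_zero_of_mem_minWall hx.1) (hs.subset inter_subset_right)

theorem volume_minWalls (h : IsCenteredSimplex c v) : volume (minWalls v) = 0 := by
  rw [minWalls_eq_iUnion, measure_iUnion_null_iff]
  exact fun p => measure_mono_null (fun x hx => inner_smul_sub_eq_zero_of_mem_minWall (c := c) hx)
    (volume_hyperplane (h.norm_inv_smul_sub p.2))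

theorem exists_countable_isFlatSet_cover_image (h : IsCenteredSimplex c v)
    {f : Euc (m + 1) → Euc (m + 1)} {L : ℝ≥0} (hf : LipschitzWith L f) {ε : ℝ} (hε : 0 < ε) :
    ∃ 𝒜 : Set (Set (Euc (m + 1))), 𝒜.Countable ∧ (∀ A ∈ 𝒜, IsCompact A ∧ IsFlatSet ε A) ∧
      μHE[m] (f '' minWalls v \ ⋃₀ 𝒜) = 0 := by
  choose T hT using fun p : {p : Fin (m + 2) × Fin (m + 2) // p.1 ≠ p.2} =>
    exists_frame_of_norm_eq_one (h.norm_inv_smul_sub p.2)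
  choose 𝒜 h𝒜c h𝒜 h0 using fun p =>
    (hf.comp (isometry_framePoint_zero (T p)).lipschitz).exists_countable_isFlatSet_cover hε
  refine ⟨⋃ p, 𝒜 p, countable_iUnion h𝒜c, ?_, ?_⟩
  · intro A hA
    obtain ⟨p, hp⟩ := mem_iUnion.1 hA
    exact h𝒜 p A hp
  · refine measure_mono_null ?_ (measure_iUnion_null h0)
    rintro _ ⟨⟨x, hx, rfl⟩, hn⟩
    rw [minWalls_eq_iUnion] at hx
    obtain ⟨p, hp⟩ := mem_iUnion.1 hx
    refine mem_iUnion.2 ⟨p, ⟨frameProj (T p) x, ?_⟩, fun hm => hn ?_⟩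
    · simp only [Function.comp]
      rw [framePoint_frameProj_of_inner_eq_zero]
      rw [hT]; exact inner_smul_sub_eq_zero_of_mem_minWall hp
    · exact sUnion_subset_sUnion (subset_iUnion 𝒜 p) hm

end IsCenteredSimplex
end

end

noncomputable section

open scoped RealInnerProductSpace ENNReal
open Filter Topology

/-- Values of real polynomials of bounded degree at `1` are a fixed linear combination of their
values at finitely many points of `(0, t₀)`. -/
theorem Polynomial.exists_eval_one_eq_sum (N : ℕ) {t₀ : ℝ} (ht₀ : 0 < t₀) :
    ∃ (s : Finset ℝ) (w : ℝ → ℝ), (∀ t ∈ s, t ∈ Ioo 0 t₀) ∧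
      ∀ p : Polynomial ℝ, p.natDegree ≤ N → p.eval 1 = ∑ t ∈ s, w t * p.eval t := by
  obtain ⟨s, hs, hcard⟩ := (Ioo_infinite ht₀).exists_subset_card_eq (N + 1)
  refine ⟨s, fun t => (Lagrange.basis s id t).eval 1, fun t ht => hs ht, fun p hp => ?_⟩
  have h := Lagrange.eq_interpolate (f := p) (s := s) (v := id) (injOn_id _)
    (by rw [hcard]; exact (Polynomial.degree_le_of_natDegree_le hp).trans_lt
          (by exact_mod_cast Nat.lt_succ_self N))
  conv_lhs => rw [h]
  simp [Lagrange.interpolate_apply, Polynomial.eval_finsetSum, mul_comm]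

section

variable {E : Type*} [NormedAddCommGroup E] [NormedSpace ℝ E]

theorem continuous_det_one_add_fderiv {u : E → E} (hu : ContDiff ℝ 1 u) :
    Continuous fun x => (1 + fderiv ℝ u x).det :=
  ContinuousLinearMap.continuous_det.comp
    (continuous_const.add (hu.continuous_fderiv one_ne_zero))

theorem hasCompactSupport_det_one_add_fderiv_sub_one {u : E → E} (huc : HasCompactSupport u) :
    HasCompactSupport fun x => (1 + fderiv ℝ u x).det - 1 :=
  huc.fderiv (𝕜 := ℝ) |>.comp_left (g := fun A : E →L[ℝ] E => (1 + A).det - 1)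
    (by simp [ContinuousLinearMap.det])

/-- `t ↦ det (1 + t A)` is polynomial of degree at most the dimension. -/
theorem ContinuousLinearMap.exists_polynomial_det_one_add_smul [FiniteDimensional ℝ E]
    (A : E →L[ℝ] E) : ∃ p : Polynomial ℝ, p.natDegree ≤ Module.finrank ℝ E ∧
      ∀ t : ℝ, p.eval t = (1 + t • A).det := by
  let b := Module.finBasis ℝ E
  let M := LinearMap.toMatrix b b A
  refine ⟨((Polynomial.X : Polynomial ℝ) • M.map Polynomial.C +
    (1 : Matrix _ _ ℝ).map Polynomial.C).det, ?_, fun t => ?_⟩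
  · simpa using Polynomial.natDegree_det_X_add_C_le M 1
  · rw [ContinuousLinearMap.det, ← LinearMap.det_toMatrix b, ← Polynomial.coe_evalRingHom,
      RingHom.map_det]
    congr 1
    have : ((1 + t • A : E →L[ℝ] E) : E →ₗ[ℝ] E) = 1 + t • (A : E →ₗ[ℝ] E) := rfl
    rw [this, LinearEquiv.map_add, LinearEquiv.map_smul, LinearMap.toMatrix_one]
    ext i j
    by_cases hij : i = j <;> simp [M, hij] <;> ring

variable [MeasurableSpace E] [BorelSpace E] (μ : Measure E)

theorem integrable_det_one_add_fderiv_sub_one [IsFiniteMeasureOnCompacts μ]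
    {u : E → E} (hu : ContDiff ℝ 1 u) (huc : HasCompactSupport u) :
    Integrable (fun x => (1 + fderiv ℝ u x).det - 1) μ :=
  ((continuous_det_one_add_fderiv hu).sub continuous_const).integrable_of_hasCompactSupport
    (hasCompactSupport_det_one_add_fderiv_sub_one huc)

variable [FiniteDimensional ℝ E] [μ.IsAddHaarMeasure]

/-- The total signed volume is unchanged by a small compactly supported perturbation of the
identity. -/
theorem integral_det_one_add_fderiv_sub_one_of_small {u : E → E} (hu : ContDiff ℝ 1 u)
    (huc : HasCompactSupport u) (hsmall : ∀ x, ‖fderiv ℝ u x‖ ≤ 1 / 2)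
    (hpos : ∀ x, 0 < (1 + fderiv ℝ u x).det) :
    ∫ x, ((1 + fderiv ℝ u x).det - 1) ∂μ = 0 := by
  set f : E → E := fun x => x + u x with hf
  have hud : Differentiable ℝ u := hu.differentiable one_ne_zero
  have hlip : LipschitzWith (1 / 2) u :=
    lipschitzWith_of_nnnorm_fderiv_le hud fun x => by
      rw [← NNReal.coe_le_coe]; simpa using hsmall x
  have happ : ApproximatesLinearOn f ((ContinuousLinearEquiv.refl ℝ E : E ≃L[ℝ] E) : E →L[ℝ] E)
      univ (1 / 2) := by
    rw [ApproximatesLinearOn.approximatesLinearOn_iff_lipschitzOnWith, lipschitzOnWith_univ]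
    convert hlip using 1
    ext x; simp [hf]
  have hc : Subsingleton E ∨ (1 / 2 : ℝ≥0) <
      ‖((ContinuousLinearEquiv.refl ℝ E).symm : E →L[ℝ] E)‖₊⁻¹ := by
    rcases subsingleton_or_nontrivial E with h | h
    · exact Or.inl h
    · right
      have : ‖((ContinuousLinearEquiv.refl ℝ E).symm : E →L[ℝ] E)‖₊ = 1 := by
        rw [← NNReal.coe_inj]; exact ContinuousLinearMap.norm_id
      rw [this, inv_one]
      exact NNReal.half_lt_self one_ne_zero
  have hinj : Function.Injective f := injOn_univ.1 (happ.injOn hc)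
  have hsurj : Function.Surjective f := happ.surjective hc
  have hfd : ∀ x, HasFDerivAt f (1 + fderiv ℝ u x) x := fun x =>
    (hasFDerivAt_id x).add (hud x).hasFDerivAt
  set K := tsupport u
  have himg : f '' K = K := by
    have hout : ∀ x ∉ K, f x = x := fun x hx => by simp [hf, image_eq_zero_of_notMem_tsupport hx]
    apply Subset.antisymm
    · rintro _ ⟨x, hx, rfl⟩
      by_contra h
      rw [hinj (hout _ h)] at h
      exact h hx
    · intro y hy
      obtain ⟨x, rfl⟩ := hsurj y
      by_cases hx : x ∈ K
      · exact ⟨x, hx, rfl⟩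
      · rw [hout x hx] at hy
        exact absurd hy hx
  have hK : IsCompact K := huc
  have key := integral_image_eq_integral_abs_det_fderiv_smul μ hK.measurableSet
    (fun x _ => (hfd x).hasFDerivWithinAt) hinj.injOn (fun _ => (1 : ℝ))
  rw [himg] at key
  have hzero : ∀ x ∉ K, (1 + fderiv ℝ u x).det - 1 = 0 := fun x hx => by
    rw [image_eq_zero_of_notMem_tsupport (f := fderiv ℝ u)
      fun h => hx (tsupport_fderiv_subset ℝ h)]
    simp [ContinuousLinearMap.det]
  rw [← setIntegral_eq_integral_of_forall_compl_eq_zero hzero,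
    integral_sub ((continuous_det_one_add_fderiv hu).continuousOn.integrableOn_compact hK)
      (continuous_const.continuousOn.integrableOn_compact hK), key, sub_eq_zero]
  refine setIntegral_congr_fun hK.measurableSet fun x _ => ?_
  simp [abs_of_pos (hpos x)]

/-- The total signed volume is unchanged by a compactly supported perturbation of the
identity. -/
theorem integral_det_one_add_fderiv_sub_one {u : E → E} (hu : ContDiff ℝ 1 u)
    (huc : HasCompactSupport u) : ∫ x, ((1 + fderiv ℝ u x).det - 1) ∂μ = 0 := by
  obtain ⟨C, hC⟩ := (huc.fderiv (𝕜 := ℝ)).exists_bound_of_continuous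
    (hu.continuous_fderiv one_ne_zero)
  have hdet : ∀ᶠ B : E →L[ℝ] E in 𝓝 0, 0 < (1 + B).det ∧ ‖B‖ ≤ 1 / 2 := by
    refine Filter.Eventually.and ?_ ?_
    · have : ContinuousAt (fun B : E →L[ℝ] E => (1 + B).det) 0 :=
        (ContinuousLinearMap.continuous_det.comp (continuous_const.add continuous_id)).continuousAt
      refine this.eventually_const_lt ?_
      simp [ContinuousLinearMap.det]
    · filter_upwards [closedBall_mem_nhds (0 : E →L[ℝ] E) (by norm_num : (0 : ℝ) < 1 / 2)]
        with B hB using by simpa using hB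
  obtain ⟨δ, hδ, hball⟩ := Metric.eventually_nhds_iff.1 hdet
  have hC0 : 0 ≤ C := (norm_nonneg _).trans (hC 0)
  obtain ⟨s, w, hs, hw⟩ := Polynomial.exists_eval_one_eq_sum (Module.finrank ℝ E)
    (t₀ := δ / (C + 1)) (by positivity)
  have hfd : ∀ (t : ℝ) x, fderiv ℝ (fun y => t • u y) x = t • fderiv ℝ u x := fun t x =>
    fderiv_fun_const_smul (hu.differentiable one_ne_zero x) t
  have hsum : ∀ x, (1 + fderiv ℝ u x).det - 1 =
      ∑ t ∈ s, w t * ((1 + fderiv ℝ (fun y => t • u y) x).det - 1) := fun x => by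
    obtain ⟨p, hp, hpe⟩ := (fderiv ℝ u x).exists_polynomial_det_one_add_smul
    have h := hw (p - 1) ((Polynomial.natDegree_sub_le _ _).trans (by simpa using hp))
    simpa [hpe, hfd] using h
  have huct : ∀ t : ℝ, HasCompactSupport fun y => t • u y := fun t => huc.smul_left
  have hut : ∀ t : ℝ, ContDiff ℝ 1 fun y => t • u y := fun t => hu.const_smul t
  simp_rw [hsum]
  rw [integral_finsetSum _ fun t _ =>
    (integrable_det_one_add_fderiv_sub_one μ (hut t) (huct t)).const_mul _]
  refine Finset.sum_eq_zero fun t ht => ?_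
  have hnorm : ∀ x, dist (fderiv ℝ (fun y => t • u y) x) 0 < δ := fun x => by
    rw [dist_zero_right, hfd, norm_smul, Real.norm_of_nonneg (hs t ht).1.le]
    have := (hs t ht).2
    rw [lt_div_iff₀ (by positivity)] at this
    have h1 := mul_le_mul_of_nonneg_left (hC x) (hs t ht).1.le
    nlinarith [(hs t ht).1]
  rw [integral_const_mul, integral_det_one_add_fderiv_sub_one_of_small μ (hut t) (huct t)
    (fun x => (hball (hnorm x)).2) (fun x => (hball (hnorm x)).1), mul_zero]

end

end

noncomputable section

open scoped RealInnerProductSpace ENNReal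
open Filter Topology

section degree

variable {E : Type*} [NormedAddCommGroup E] [NormedSpace ℝ E] [FiniteDimensional ℝ E]

theorem ContinuousLinearMap.det_one_add_smulRight_mul (A : E →L[ℝ] E) (l : E →L[ℝ] ℝ) (e : E) :
    (A + (l.comp A).smulRight e).det = (1 + l e) * A.det := by
  have : ((A + (l.comp A).smulRight e : E →L[ℝ] E) : E →ₗ[ℝ] E) =
      LinearMap.transvection (l : E →ₗ[ℝ] ℝ) e * (A : E →ₗ[ℝ] E) := by
    ext x
    simp [LinearMap.transvection]
  rw [ContinuousLinearMap.det, this, map_mul, LinearMap.transvection.det]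
  rfl

variable [MeasurableSpace E] [BorelSpace E] (μ : Measure E) [μ.IsAddHaarMeasure]

theorem setIntegral_fderiv_mul_det_eq_zero {u : E → E} (hu : ContDiff ℝ 1 u)
    (huc : HasCompactSupport u) {Ω : Set E} (hΩ : IsOpen Ω) (hb : Bornology.IsBounded Ω)
    {G : E → ℝ} (hG : ContDiff ℝ 1 G) (hGΩ : ∀ x ∈ frontier Ω, x + u x ∉ tsupport G) (e : E) :
    ∫ x in Ω, fderiv ℝ G (x + u x) e * (1 + fderiv ℝ u x).det ∂μ = 0 := by
  have hψ : ContDiff ℝ 1 fun x => x + u x := contDiff_id.add hu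
  have hGψ : ContDiff ℝ 1 fun x => G (x + u x) := hG.comp hψ
  set H : E → ℝ := Ω.indicator fun x => G (x + u x) with hH
  have hin : ∀ x ∈ Ω, H =ᶠ[𝓝 x] fun x => G (x + u x) := fun x hx => by
    filter_upwards [hΩ.mem_nhds hx] with y hy using indicator_of_mem hy _
  have hout : ∀ x ∉ Ω, H =ᶠ[𝓝 x] 0 := fun x hx => by
    by_cases hx' : x ∈ closure Ω
    · have h1 : ∀ᶠ y in 𝓝 x, y + u y ∉ tsupport G :=
        hψ.continuous.continuousAt.eventually
          ((isClosed_tsupport G).isOpen_compl.mem_nhds (hGΩ x ⟨hx', by rwa [hΩ.interior_eq]⟩))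
      filter_upwards [h1] with y hy
      by_cases hyΩ : y ∈ Ω
      · rw [hH, indicator_of_mem hyΩ, image_eq_zero_of_notMem_tsupport hy]; rfl
      · rw [hH, indicator_of_notMem hyΩ]; rfl
    · filter_upwards [isClosed_closure.isOpen_compl.mem_nhds hx'] with y hy
      exact indicator_of_notMem (fun h => hy (subset_closure h)) _
  have hHsmooth : ContDiff ℝ 1 H := contDiff_iff_contDiffAt.2 fun x => by
    by_cases hx : x ∈ Ω
    · exact hGψ.contDiffAt.congr_of_eventuallyEq (hin x hx)
    · exact contDiffAt_const.congr_of_eventuallyEq (hout x hx)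
  have hHc : HasCompactSupport H :=
    HasCompactSupport.intro hb.isCompact_closure fun x hx =>
      indicator_of_notMem (fun h => hx (subset_closure h)) _
  have hu' : ContDiff ℝ 1 fun x => u x + H x • e := hu.add (hHsmooth.smul contDiff_const)
  have huc' : HasCompactSupport fun x => u x + H x • e := huc.add hHc.smul_right
  have hdiff : ∀ x, (1 + fderiv ℝ (fun x => u x + H x • e) x).det - 1 -
      ((1 + fderiv ℝ u x).det - 1) =
      Ω.indicator (fun x => fderiv ℝ G (x + u x) e * (1 + fderiv ℝ u x).det) x := fun x => by
    have hD : fderiv ℝ (fun x => u x + H x • e) x =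
        fderiv ℝ u x + (fderiv ℝ H x).smulRight e :=
      ((hu.differentiable one_ne_zero x).hasFDerivAt.add
        ((hHsmooth.differentiable one_ne_zero x).hasFDerivAt.smul_const e)).fderiv
    rw [hD, ← add_assoc]
    by_cases hx : x ∈ Ω
    · have hDH : fderiv ℝ H x = (fderiv ℝ G (x + u x)).comp (1 + fderiv ℝ u x) := by
        rw [(hin x hx).fderiv_eq]
        exact ((hG.differentiable one_ne_zero _).hasFDerivAt.comp x
          ((hasFDerivAt_id x).add (hu.differentiable one_ne_zero x).hasFDerivAt)).fderiv
      rw [indicator_of_mem hx, hDH, ContinuousLinearMap.det_one_add_smulRight_mul]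
      ring
    · rw [indicator_of_notMem hx, (hout x hx).fderiv_eq]
      simp
  rw [← integral_indicator hΩ.measurableSet, ← integral_congr_ae (ae_of_all _ hdiff),
    integral_sub (integrable_det_one_add_fderiv_sub_one μ hu' huc')
      (integrable_det_one_add_fderiv_sub_one μ hu huc),
    integral_det_one_add_fderiv_sub_one μ hu' huc', integral_det_one_add_fderiv_sub_one μ hu huc,
    sub_zero]

/-- The mollified degree over `Ω` of `x ↦ x + u x` has zero derivative away from the image of
the frontier. -/
theorem hasFDerivAt_setIntegral_mollifier_mul_det {u : E → E} (hu : ContDiff ℝ 1 u)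
    (huc : HasCompactSupport u) {Ω : Set E} (hΩ : IsOpen Ω) (hb : Bornology.IsBounded Ω)
    (η : ContDiffBump (0 : E)) {y : E}
    (hy : ∀ x ∈ frontier Ω, x + u x ∉ closedBall y η.rOut) :
    HasFDerivAt (fun y => ∫ x in Ω, η (x + u x - y) * (1 + fderiv ℝ u x).det ∂μ)
      (0 : E →L[ℝ] ℝ) y := by
  have hη : ContDiff ℝ 1 η := η.contDiff
  have hcont : Continuous fun x => (1 + fderiv ℝ u x).det := continuous_det_one_add_fderiv hu
  have hKc : IsCompact (closure Ω) := hb.isCompact_closure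
  have hint : ∀ {f : E → ℝ}, Continuous f →
      Integrable f (μ.restrict Ω) := fun hf =>
    (hf.continuousOn.integrableOn_compact hKc).mono_set subset_closure
  obtain ⟨C₁, hC₁⟩ := (η.hasCompactSupport.fderiv (𝕜 := ℝ)).exists_bound_of_continuous
    (hη.continuous_fderiv one_ne_zero)
  have hF' : ∀ y, Continuous fun x =>
      (1 + fderiv ℝ u x).det • -fderiv ℝ η (x + u x - y) := fun y =>
    hcont.smul ((hη.continuous_fderiv one_ne_zero).comp
      ((continuous_id.add hu.continuous).sub continuous_const)).neg
  have hD : ∀ x z, HasFDerivAt (fun y => η (x + u x - y) * (1 + fderiv ℝ u x).det)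
      ((1 + fderiv ℝ u x).det • -fderiv ℝ η (x + u x - z)) z := fun x z => by
    have h1 : HasFDerivAt (fun y : E => x + u x - y) (-ContinuousLinearMap.id ℝ E) z :=
      (hasFDerivAt_id z).const_sub (x + u x)
    refine (((hη.differentiable one_ne_zero _).hasFDerivAt.comp z h1).mul_const
      ((1 + fderiv ℝ u x).det)).congr_fderiv ?_
    ext; simp
  have key := hasFDerivAt_integral_of_dominated_of_fderiv_le (μ := μ.restrict Ω) (x₀ := y)
    (F := fun y x => η (x + u x - y) * (1 + fderiv ℝ u x).det)
    (F' := fun y x => (1 + fderiv ℝ u x).det • -fderiv ℝ η (x + u x - y))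
    (bound := fun x => ‖(1 + fderiv ℝ u x).det‖ * C₁) univ_mem
    (Eventually.of_forall fun z => ((hη.continuous.comp
      ((continuous_id.add hu.continuous).sub continuous_const)).mul hcont).aestronglyMeasurable)
    (hint ((hη.continuous.comp
      ((continuous_id.add hu.continuous).sub continuous_const)).mul hcont))
    (hF' y).aestronglyMeasurable
    (ae_of_all _ fun x z _ => by
      rw [norm_smul, norm_neg]
      exact mul_le_mul_of_nonneg_left (hC₁ _) (norm_nonneg _))
    (hint (hcont.norm.mul continuous_const))
    (ae_of_all _ fun x z _ => hD x z)
  have hzero : ∫ x in Ω, (1 + fderiv ℝ u x).det • -fderiv ℝ η (x + u x - y) ∂μ = 0 := by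
    ext e
    rw [ContinuousLinearMap.integral_apply
      (((hF' y).continuousOn.integrableOn_compact hKc).mono_set subset_closure)]
    have hG : ContDiff ℝ 1 fun z => η (z - y) := hη.comp (contDiff_id.sub contDiff_const)
    have hGs : tsupport (fun z => η (z - y)) ⊆ closedBall y η.rOut := by
      refine closure_minimal (fun z hz => ?_) isClosed_closedBall
      by_contra h
      refine hz (η.zero_of_le_dist ?_)
      rw [mem_closedBall, not_le, dist_eq_norm] at h
      rw [dist_zero_right]; exact h.le
    have h0 := setIntegral_fderiv_mul_det_eq_zero μ hu huc hΩ hb hG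
      (fun x hx h => hy x hx (hGs h)) e
    have hfd : ∀ z, fderiv ℝ (fun z => η (z - y)) z = fderiv ℝ η (z - y) := fun z =>
      fderiv_comp_sub y
    simp only [hfd] at h0
    rw [zero_apply, ← neg_eq_zero, ← integral_neg, ← h0]
    congr 1
    ext x
    simp [mul_comm]
  rwa [hzero] at key

/-- A compact connected set that misses the image of the frontier of `Ω` cannot join a point of `Ω`
to a point outside `Ω`, when both points lie outside of the ball in which the map moves points. -/
theorem mem_of_isPreconnected_of_disjoint_image_frontier {φ : E → E} (hφ : Continuous φ) {R : ℝ}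
    (hout : ∀ x, R ≤ ‖x‖ → φ x = x) (hin : ∀ x, ‖x‖ ≤ R → ‖φ x‖ ≤ R)
    {Ω K : Set E} (hΩ : IsOpen Ω) (hb : Bornology.IsBounded Ω) (hK : IsPreconnected K)
    (hKc : IsCompact K) (hKΩ : Disjoint K (φ '' frontier Ω)) {a b : E} (haK : a ∈ K)
    (hbK : b ∈ K) (ha : R < ‖a‖) (hbR : R < ‖b‖) (haΩ : a ∈ Ω) : b ∈ Ω := by
  borelize E
  set μ : Measure E := Measure.addHaar
  by_contra hbΩ
  have hfr : IsCompact (frontier Ω) :=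
    hb.isCompact_closure.of_isClosed_subset isClosed_frontier frontier_subset_closure
  have hbcl : b ∉ closure Ω := fun h =>
    disjoint_left.1 hKΩ hbK ⟨b, ⟨h, by rwa [hΩ.interior_eq]⟩, hout b hbR.le⟩
  obtain ⟨δ₁, hδ₁, hd⟩ := hKΩ.exists_cthickenings hKc (hfr.image hφ).isClosed
  obtain ⟨δ₂, hδ₂, haδ⟩ := Metric.isOpen_iff.1 hΩ a haΩ
  obtain ⟨δ₃, hδ₃, hbδ⟩ := Metric.isOpen_iff.1 isClosed_closure.isOpen_compl b hbcl
  obtain ⟨δ, hδ, hδle⟩ : ∃ δ > 0, 2 * δ ≤ δ₁ ∧ δ ≤ δ₂ ∧ δ ≤ δ₃ ∧ 2 * δ ≤ ‖a‖ - R ∧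
      2 * δ ≤ ‖b‖ - R := by
    set M := min (min δ₁ (min δ₂ δ₃)) (min (‖a‖ - R) (‖b‖ - R)) with hM
    have hM0 : 0 < M := by
      simp only [hM, lt_min_iff, sub_pos]
      exact ⟨⟨hδ₁, hδ₂, hδ₃⟩, ha, hbR⟩
    have h := hM.le
    simp only [le_min_iff] at h
    obtain ⟨⟨h1, h2, h3⟩, h4, h5⟩ := h
    exact ⟨M / 2, by linarith, by linarith, by linarith, by linarith, by linarith, by linarith⟩
  obtain ⟨hδ1, hδ2, hδ3, hδa, hδb⟩ := hδle
  obtain ⟨u, hu, huφ, husupp⟩ := (hφ.sub continuous_id).exists_contDiff_approx 1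
    continuous_const fun _ => hδ
  have hu0 : ∀ x, R ≤ ‖x‖ → u x = 0 := fun x hx => by
    by_contra h
    exact husupp h (by simp [hout x hx])
  have huc : HasCompactSupport u :=
    HasCompactSupport.intro (isCompact_closedBall 0 R) fun x hx => hu0 x (by
      rw [mem_closedBall, dist_zero_right, not_le] at hx; exact hx.le)
  have hdist : ∀ x, dist (x + u x) (φ x) < δ := fun x => by
    have := huφ x
    rw [dist_eq_norm] at this ⊢
    convert this using 2
    simp; abel
  let η : ContDiffBump (0 : E) := ⟨δ / 2, δ, half_pos hδ, half_lt_self hδ⟩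
  set D : E → ℝ := fun y => ∫ x in Ω, η (x + u x - y) * (1 + fderiv ℝ u x).det ∂μ with hDdef
  set U : Set E := (cthickening (2 * δ) (φ '' frontier Ω))ᶜ
  have hU : IsOpen U := isClosed_cthickening.isOpen_compl
  have hKU : K ⊆ U := fun y hy h =>
    disjoint_left.1 hd (self_subset_cthickening _ hy) (cthickening_mono hδ1 _ h)
  have hDfd : ∀ y ∈ U, HasFDerivAt D 0 y := fun y hy =>
    hasFDerivAt_setIntegral_mollifier_mul_det μ hu huc hΩ hb η fun x hx h => hy
      (mem_cthickening_of_dist_le y (φ x) _ _ (mem_image_of_mem φ hx) (by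
        have h1 : dist (x + u x) y ≤ δ := h
        linarith [hdist x, dist_triangle_left y (φ x) (x + u x)]))
  have hDeq : D a = D b := by
    have hs : IsOpen (connectedComponentIn U a) := hU.connectedComponentIn
    refine hs.is_const_of_fderiv_eq_zero (𝕜 := ℝ) isPreconnected_connectedComponentIn
      (fun y hy => ((hDfd y (connectedComponentIn_subset _ _ hy)).differentiableAt
        ).differentiableWithinAt)
      (fun y hy => (hDfd y (connectedComponentIn_subset _ _ hy)).fderiv)
      (mem_connectedComponentIn (hKU haK))
      (hK.subset_connectedComponentIn haK hKU hbK)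
  have hfar : ∀ y, 2 * δ ≤ ‖y‖ - R → D y = ∫ x in Ω, η (x - y) ∂μ := fun y hy => by
    refine setIntegral_congr_fun hΩ.measurableSet fun x _ => ?_
    rcases lt_or_ge R ‖x‖ with hx | hx
    · have : fderiv ℝ u x = 0 := by
        have : u =ᶠ[𝓝 x] 0 := by
          filter_upwards [continuous_norm.continuousAt.eventually_const_lt hx] with z hz
            using hu0 z hz.le
        rw [this.fderiv_eq]; simp
      simp [this, hu0 x hx.le, ContinuousLinearMap.det]
    · have h1 : ‖φ x‖ ≤ R := hin x hx
      have h2 := hdist x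
      rw [dist_eq_norm] at h2
      have h3 : η.rOut ≤ dist (x + u x - y) 0 := by
        rw [dist_zero_right]
        have := norm_sub_norm_le y (x + u x)
        have := norm_sub_norm_le (x + u x) (φ x)
        rw [norm_sub_rev (x + u x) y]
        change δ ≤ _
        linarith
      have h4 : η.rOut ≤ dist (x - y) 0 := by
        rw [dist_zero_right, norm_sub_rev]
        have := norm_sub_norm_le y x
        change δ ≤ _
        linarith
      rw [η.zero_of_le_dist h3, η.zero_of_le_dist h4, zero_mul]
  have hDb : D b = 0 := by
    rw [hfar b hδb]
    refine setIntegral_eq_zero_of_forall_eq_zero fun x hx => η.zero_of_le_dist ?_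
    rw [dist_zero_right, ← dist_eq_norm]
    by_contra! h
    exact hbδ (lt_of_lt_of_le h hδ3) (subset_closure hx)
  have hDa : 0 < D a := by
    rw [hfar a hδa, setIntegral_eq_integral_of_forall_compl_eq_zero, integral_sub_right_eq_self]
    · exact η.integral_pos
    · intro x hx
      refine η.zero_of_le_dist ?_
      rw [dist_zero_right, ← dist_eq_norm]
      by_contra! h
      exact hx (haδ (lt_of_lt_of_le h hδ2))
  linarith

end degree

end

noncomputable section

open scoped RealInnerProductSpace ENNReal
open Filter Topology

section labelling

variable {m : ℕ} {v : Fin (m + 2) → Euc (m + 1)} {c R : ℝ} {φ : Euc (m + 1) → Euc (m + 1)}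

theorem frontier_minCell_subset (i : Fin (m + 2)) : frontier (minCell v i) ⊆ minWalls v := by
  intro x hx
  rw [(isOpen_minCell i).frontier_eq] at hx
  refine (exists_mem_minCell_or_minWall x).resolve_left ?_
  rintro ⟨j, hj⟩
  have hij : i ≠ j := fun h => hx.2 (h ▸ hj)
  exact disjoint_left.1 ((disjoint_minCell hij).closure_left (isOpen_minCell j)) hx.1 hj

theorem disjoint_minCell_minWalls (i : Fin (m + 2)) : Disjoint (minCell v i) (minWalls v) :=
  disjoint_left.2 fun _ hx ⟨_, _, hjk, hw⟩ => disjoint_left.1 (disjoint_minCell_minWall i hjk) hx hw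

theorem image_sdiff_closedBall_eq {E : Type*} [NormedAddCommGroup E] {R : ℝ} {φ : E → E}
    (hout : ∀ x, R ≤ ‖x‖ → φ x = x) (hin : ∀ x, ‖x‖ ≤ R → ‖φ x‖ ≤ R) (s : Set E) {r : ℝ}
    (hr : R ≤ r) : φ '' s \ closedBall 0 r = s \ closedBall 0 r := by
  ext y
  simp only [Set.mem_sdiff, mem_closedBall, dist_zero_right, not_le]
  constructor
  · rintro ⟨⟨x, hx, rfl⟩, hy⟩
    have hxR : R ≤ ‖x‖ := by
      by_contra! h
      linarith [hin x h.le]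
    rw [hout x hxR] at hy ⊢
    exact ⟨hx, hy⟩
  · rintro ⟨hy, hyr⟩
    exact ⟨⟨y, hy, hout y (hr.trans hyr.le)⟩, hyr⟩

theorem isClosed_image_of_eq_outside {E : Type*} [NormedAddCommGroup E] [ProperSpace E] {R : ℝ}
    {φ : E → E} (hφ : Continuous φ) (hout : ∀ x, R ≤ ‖x‖ → φ x = x) {s : Set E}
    (hs : IsClosed s) : IsClosed (φ '' s) := by
  have : φ '' s = φ '' (s ∩ closedBall 0 R) ∪ s \ ball 0 R := by
    ext y
    constructor
    · rintro ⟨x, hx, rfl⟩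
      by_cases h : x ∈ ball 0 R
      · exact Or.inl ⟨x, ⟨hx, ball_subset_closedBall h⟩, rfl⟩
      · right
        have hR : R ≤ ‖x‖ := by simpa using h
        rw [hout x hR]
        exact ⟨hx, h⟩
    · rintro (⟨x, hx, rfl⟩ | hy)
      · exact ⟨x, hx.1, rfl⟩
      · exact ⟨y, hy.1, hout y (by simpa using hy.2)⟩
  rw [this]
  exact (((isCompact_closedBall 0 R).inter_left hs).image hφ).isClosed.union
    (hs.sdiff isOpen_ball)

/-- Points of different cells far from the origin lie in different components of the complement of
the deformed walls. -/
theorem eq_of_mem_connectedComponentIn_compl_image_minWalls (hφ : Continuous φ)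
    (hout : ∀ x, R ≤ ‖x‖ → φ x = x) (hin : ∀ x, ‖x‖ ≤ R → ‖φ x‖ ≤ R) {i j : Fin (m + 2)}
    {a b : Euc (m + 1)} (ha : a ∈ minCell v i) (hb : b ∈ minCell v j) (haR : R < ‖a‖)
    (hbR : R < ‖b‖) (hab : b ∈ connectedComponentIn (φ '' minWalls v)ᶜ a) : i = j := by
  by_contra hij
  have hF : IsClosed (φ '' minWalls v) := isClosed_image_of_eq_outside hφ hout isClosed_minWalls
  have haF : a ∈ (φ '' minWalls v)ᶜ := by
    by_contra h
    rw [connectedComponentIn_eq_empty h] at hab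
    exact hab
  have hpath : IsPathConnected (connectedComponentIn (φ '' minWalls v)ᶜ a) :=
    (hF.isOpen_compl.connectedComponentIn).isConnected_iff_isPathConnected.1
      (isConnected_connectedComponentIn_iff.2 haF)
  obtain ⟨γ, hγ⟩ := hpath.joinedIn a (mem_connectedComponentIn haF) b hab
  have hKc : IsCompact (range γ) := isCompact_range γ.continuous
  obtain ⟨ρ, hρ⟩ := hKc.isBounded.subset_ball 0
  have haK : a ∈ range γ := ⟨0, γ.source⟩
  have hbK : b ∈ range γ := ⟨1, γ.target⟩
  have haρ : ‖a‖ < ρ := by simpa using hρ haK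
  have hb' : b ∈ minCell v i ∩ ball 0 ρ := by
    refine mem_of_isPreconnected_of_disjoint_image_frontier hφ hout hin
      ((isOpen_minCell i).inter isOpen_ball) (isBounded_ball.subset inter_subset_right)
      (isPreconnected_range γ.continuous) hKc ?_ haK hbK haR hbR ⟨ha, by simpa using haρ⟩
    refine disjoint_left.2 ?_
    rintro y hy ⟨x, hx, rfl⟩
    obtain ⟨t, ht⟩ := hy
    rcases frontier_inter_subset _ _ hx with hx | hx
    · have h1 := connectedComponentIn_subset _ _ (hγ t)
      rw [ht] at h1
      exact h1 ⟨x, frontier_minCell_subset i hx.1, rfl⟩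
    · have hxρ : ‖x‖ = ρ := by simpa using frontier_ball_subset_sphere hx.2
      have h1 : ‖φ x‖ < ρ := by simpa [ht] using hρ ⟨t, ht⟩
      rw [hout x (by linarith), hxρ] at h1
      exact lt_irrefl _ h1
  exact disjoint_left.1 (disjoint_minCell hij) hb'.1 hb

theorem exists_labelling (h : IsCenteredSimplex c v) (hφ : Continuous φ)
    (hout : ∀ x, R ≤ ‖x‖ → φ x = x) (hin : ∀ x, ‖x‖ ≤ R → ‖φ x‖ ≤ R) :
    ∃ W : Euc (m + 1) → Euc (m + 1), Measurable W ∧ (∀ x y, ‖W x - W y‖ ≤ c) ∧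
      (∀ x ∉ φ '' minWalls v, ∀ᶠ y in 𝓝 x, W y = W x) ∧
      ∀ i, ∀ x ∈ minCell v i, R < ‖x‖ → W x = v i := by
  classical
  set F := φ '' minWalls v
  have hF : IsClosed F := isClosed_image_of_eq_outside hφ hout isClosed_minWalls
  have hcF : ∀ i, ∀ x ∈ minCell v i, R < ‖x‖ → x ∈ Fᶜ := fun i x hx hxR hxF => by
    have : x ∈ F \ closedBall 0 R := ⟨hxF, by simpa using hxR⟩
    rw [image_sdiff_closedBall_eq hout hin _ le_rfl] at this
    exact disjoint_left.1 (disjoint_minCell_minWalls i) hx this.1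
  set V : Fin (m + 2) → Set (Euc (m + 1)) := fun i =>
    ⋃ a ∈ minCell v i \ closedBall 0 R, connectedComponentIn Fᶜ a with hV
  have hVmem : ∀ {i y}, y ∈ V i ↔ ∃ a ∈ minCell v i, R < ‖a‖ ∧ y ∈ connectedComponentIn Fᶜ a := by
    intro i y
    simp [hV, and_assoc]
  have hVo : ∀ i, IsOpen (V i) := fun i =>
    isOpen_biUnion fun a _ => hF.isOpen_compl.connectedComponentIn
  have hVu : ∀ {i j y}, y ∈ V i → y ∈ V j → i = j := by
    intro i j y hi hj
    obtain ⟨a, ha, haR, hya⟩ := hVmem.1 hi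
    obtain ⟨b, hb, hbR, hyb⟩ := hVmem.1 hj
    refine eq_of_mem_connectedComponentIn_compl_image_minWalls hφ hout hin ha hb haR hbR ?_
    change b ∈ connectedComponentIn Fᶜ a
    rw [connectedComponentIn_eq hya, ← connectedComponentIn_eq hyb]
    exact mem_connectedComponentIn (hcF j b hb hbR)
  set W : Euc (m + 1) → Euc (m + 1) := fun y => v 0 + ∑ i, (V i).indicator (fun _ => v i - v 0) y
    with hW
  have hWV : ∀ {i y}, y ∈ V i → W y = v i := by
    intro i y hy
    rw [hW]
    simp only
    rw [Finset.sum_eq_single i, indicator_of_mem hy, add_sub_cancel]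
    · exact fun j _ hji => indicator_of_notMem (fun hj => hji (hVu hj hy)) _
    · simp
  have hW0 : ∀ {y}, (∀ i, y ∉ V i) → W y = v 0 := by
    intro y hy
    rw [hW]
    simp only
    rw [Finset.sum_eq_zero fun i _ => indicator_of_notMem (hy i) _, add_zero]
  have hWr : ∀ y, ∃ i, W y = v i := fun y => by
    by_cases hy : ∃ i, y ∈ V i
    · exact ⟨_, hWV hy.choose_spec⟩
    · exact ⟨0, hW0 (not_exists.1 hy)⟩
  refine ⟨W, ?_, fun x y => ?_, fun x hx => ?_, fun i x hx hxR => hWV (hVmem.2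
    ⟨x, hx, hxR, mem_connectedComponentIn (hcF i x hx hxR)⟩)⟩
  · exact measurable_const.add (Finset.measurable_fun_sum _ fun i _ =>
      measurable_const.indicator (hVo i).measurableSet)
  · obtain ⟨i, hi⟩ := hWr x
    obtain ⟨j, hj⟩ := hWr y
    rw [hi, hj]
    by_cases hij : i = j
    · simpa [hij] using h.pos.le
    · exact (h.norm_sub_eq i j hij).le
  · by_cases hy : ∃ i, x ∈ V i
    · obtain ⟨i, hi⟩ := hy
      filter_upwards [(hVo i).mem_nhds hi] with y hy
      rw [hWV hy, hWV hi]
    · have hx' := not_exists.1 hy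
      filter_upwards [hF.isOpen_compl.connectedComponentIn.mem_nhds
        (mem_connectedComponentIn (x := x) hx)] with z hz
      rw [hW0 hx', hW0]
      intro i hzi
      obtain ⟨a, ha, haR, hza⟩ := hVmem.1 hzi
      refine hx' i (hVmem.2 ⟨a, ha, haR, ?_⟩)
      rw [connectedComponentIn_eq hza, ← connectedComponentIn_eq hz]
      exact mem_connectedComponentIn hx

end labelling

end

noncomputable section

open scoped RealInnerProductSpace ENNReal
open Filter Topology

section minimality

variable {m : ℕ} {v : Fin (m + 2) → Euc (m + 1)} {c R : ℝ} {φ : Euc (m + 1) → Euc (m + 1)}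

theorem euclideanHausdorffMeasure_image_inter_closedBall_lt_top {L : ℝ≥0}
    (hφ : LipschitzWith L φ) (hout : ∀ x, R ≤ ‖x‖ → φ x = x) {s : Set (Euc (m + 1))}
    (hs : ∀ r, μHE[m] (s ∩ closedBall 0 r) < ⊤) (r : ℝ) :
    μHE[m] (φ '' s ∩ closedBall 0 r) < ⊤ := by
  have hsub : φ '' s ∩ closedBall 0 r ⊆ φ '' (s ∩ closedBall 0 (max r R)) := by
    rintro _ ⟨⟨x, hx, rfl⟩, hr⟩
    refine ⟨x, ⟨hx, ?_⟩, rfl⟩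
    rw [mem_closedBall, dist_zero_right] at hr ⊢
    by_contra! h
    rw [hout x ((le_max_right _ _).trans h.le)] at hr
    exact absurd (hr.trans (le_max_left _ _)) h.not_ge
  exact (measure_mono hsub).trans_lt
    ((hφ.lipschitzOnWith.euclideanHausdorffMeasure_image_le m).trans_lt
      (ENNReal.mul_lt_top (by simp) (hs _)))

theorem integral_fderiv_labelling_eq_sum (h : IsCenteredSimplex c v) {W : Euc (m + 1) → Euc (m + 1)}
    (hWv : ∀ i, ∀ x ∈ minCell v i, R < ‖x‖ → W x = v i) {ζ : Euc (m + 1) → ℝ}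
    (hζ : ContDiff ℝ 1 ζ) (hζc : HasCompactSupport ζ) (hζR : ∀ x, ‖x‖ ≤ R → fderiv ℝ ζ x = 0) :
    ∫ x, fderiv ℝ ζ x (W x) = ∑ i, ∫ x in minCell v i, fderiv ℝ ζ x (v i) := by
  have hint : ∀ i, Integrable fun x => fderiv ℝ ζ x (v i) := fun i =>
    integrable_fderiv_apply measurable_const (fun _ => le_rfl) hζ hζc
  simp_rw [← fun i => integral_indicator (μ := volume) (f := fun x => fderiv ℝ ζ x (v i))
    (isOpen_minCell (v := v) i).measurableSet]
  rw [← integral_finsetSum _ fun i _ => (hint i).indicator (isOpen_minCell i).measurableSet]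
  refine integral_congr_ae ?_
  filter_upwards [compl_mem_ae_iff.2 h.volume_minWalls] with x hx
  obtain ⟨k, hk⟩ := (exists_mem_minCell_or_minWall x).resolve_right hx
  rw [Finset.sum_eq_single k, indicator_of_mem hk]
  · rcases le_or_gt ‖x‖ R with hxR | hxR
    · simp [hζR x hxR]
    · rw [hWv k x hk hxR]
  · exact fun i _ hik => indicator_of_notMem (disjoint_left.1 (disjoint_minCell hik.symm) hk) _
  · simp

/-- Deforming the walls inside a ball does not decrease their measure in this ball. -/
theorem IsCenteredSimplex.euclideanHausdorffMeasure_minWalls_inter_closedBall_le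
    (h : IsCenteredSimplex c v) {L : ℝ≥0} (hφ : LipschitzWith L φ) (hR : 0 < R)
    (hout : ∀ x, R ≤ ‖x‖ → φ x = x) (hin : ∀ x, ‖x‖ ≤ R → ‖φ x‖ ≤ R) :
    μHE[m] (minWalls v ∩ closedBall 0 R) ≤ μHE[m] (φ '' minWalls v ∩ closedBall 0 R) := by
  set E := minWalls v with hE
  set F := φ '' E with hFdef
  have hF : IsClosed F := isClosed_image_of_eq_outside hφ.continuous hout isClosed_minWalls
  have hEfin : ∀ r, μHE[m] (E ∩ closedBall 0 r) < ⊤ := fun r =>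
    h.euclideanHausdorffMeasure_minWalls_inter_lt_top isBounded_closedBall
  obtain ⟨W, hWm, hWc, hWloc, hWv⟩ := exists_labelling h hφ.continuous hout hin
  let ζ : ContDiffBump (0 : Euc (m + 1)) := ⟨R + 1, R + 2, by linarith, by linarith⟩
  have hζ : ContDiff ℝ 1 ζ := ζ.contDiff
  have hζ1 : ∀ x ∈ closedBall (0 : Euc (m + 1)) R, ζ x = 1 := fun x hx =>
    ζ.one_of_mem_closedBall (closedBall_subset_closedBall (by simp [ζ]) hx)
  have hζR : ∀ x : Euc (m + 1), ‖x‖ ≤ R → fderiv ℝ ζ x = 0 := fun x hx => by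
    rw [(ζ.eventuallyEq_one_of_mem_ball (x := x) ?_).fderiv_eq]
    · simp
    · rw [mem_ball, dist_zero_right]
      exact lt_of_le_of_lt hx (by simp [ζ])
  have hle : ∫⁻ x in E, ‖ζ x‖ₑ ∂μHE[m] ≤ ∫⁻ x in F, ‖ζ x‖ₑ ∂μHE[m] := by
    rw [← ENNReal.mul_le_mul_iff_right (a := ENNReal.ofReal c) (by simpa using h.pos) (by simp)]
    calc ENNReal.ofReal c * ∫⁻ x in E, ‖ζ x‖ₑ ∂μHE[m]
        ≤ ENNReal.ofReal (∑ i, ∫ x in minCell v i, fderiv ℝ ζ x (v i)) :=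
          h.lintegral_iUnion_minWall_le hζ ζ.hasCompactSupport fun _ => ζ.nonneg
      _ = ENNReal.ofReal (∫ x, fderiv ℝ ζ x (W x)) := by
          rw [integral_fderiv_labelling_eq_sum h hWv hζ ζ.hasCompactSupport hζR]
      _ ≤ ‖∫ x, fderiv ℝ ζ x (W x)‖ₑ := Real.ofReal_le_enorm _
      _ ≤ ENNReal.ofReal c * ∫⁻ x in F, ‖ζ x‖ₑ ∂μHE[m] :=
          enorm_integral_fderiv_apply_le hF
            (euclideanHausdorffMeasure_image_inter_closedBall_lt_top hφ hout hEfin)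
            (fun ε hε => h.exists_countable_isFlatSet_cover_image hφ hε)
            hWm hWc hWloc hζ ζ.hasCompactSupport
  have hsplit : ∀ s : Set (Euc (m + 1)), MeasurableSet s → ∫⁻ x in s, ‖ζ x‖ₑ ∂μHE[m] =
      μHE[m] (s ∩ closedBall 0 R) + ∫⁻ x in s \ closedBall 0 R, ‖ζ x‖ₑ ∂μHE[m] := fun s hs => by
    rw [← lintegral_inter_add_sdiff (fun x => ‖ζ x‖ₑ) s (isClosed_closedBall (x := 0)
      (ε := R)).measurableSet]
    congr 1
    rw [← setLIntegral_one]
    refine setLIntegral_congr_fun (hs.inter isClosed_closedBall.measurableSet) fun x hx => ?_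
    simp [hζ1 x hx.2]
  have hfin : ∫⁻ x in E \ closedBall 0 R, ‖ζ x‖ₑ ∂μHE[m] ≠ ⊤ := by
    have h1 : ∫⁻ x in E \ closedBall 0 R, ‖ζ x‖ₑ ∂μHE[m] ≤
        ∫⁻ x in E, (closedBall 0 (R + 2)).indicator 1 x ∂μHE[m] := by
      refine (lintegral_mono_set sdiff_subset).trans (lintegral_mono fun x => ?_)
      by_cases hx : x ∈ closedBall (0 : Euc (m + 1)) (R + 2)
      · rw [indicator_of_mem hx, Real.enorm_eq_ofReal ζ.nonneg]
        simpa using ζ.le_one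
      · rw [ζ.zero_of_le_dist (not_le.1 hx).le]
        simp
    refine (h1.trans_lt ?_).ne
    rw [lintegral_indicator_one isClosed_closedBall.measurableSet,
      Measure.restrict_apply isClosed_closedBall.measurableSet, inter_comm]
    exact hEfin _
  rw [hsplit E isClosed_minWalls.measurableSet, hsplit F hF.measurableSet,
    image_sdiff_closedBall_eq hout hin E le_rfl] at hle
  exact (ENNReal.add_le_add_iff_right hfin).1 hle

theorem IsCenteredSimplex.euclideanHausdorffMeasure_minWalls_sdiff_le
    (h : IsCenteredSimplex c v) {L : ℝ≥0} (hφ : LipschitzWith L φ) (hR : 0 < R)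
    (hout : ∀ x, R ≤ ‖x‖ → φ x = x) (hin : ∀ x, ‖x‖ ≤ R → ‖φ x‖ ≤ R) :
    μHE[m] (minWalls v \ φ '' minWalls v) ≤ μHE[m] (φ '' minWalls v \ minWalls v) := by
  have hle := h.euclideanHausdorffMeasure_minWalls_inter_closedBall_le hφ hR hout hin
  have hEfin : μHE[m] (minWalls v ∩ closedBall 0 R) < ⊤ :=
    h.euclideanHausdorffMeasure_minWalls_inter_lt_top isBounded_closedBall
  have hE : IsClosed (minWalls v) := isClosed_minWalls
  have hF : IsClosed (φ '' minWalls v) := isClosed_image_of_eq_outside hφ.continuous hout hE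
  have heq := image_sdiff_closedBall_eq hout hin (minWalls v) le_rfl
  set E := minWalls v
  set F := φ '' E
  set B := closedBall (0 : Euc (m + 1)) R
  have hEF : E \ F = (E ∩ B) \ F := by
    ext x
    simp only [Set.mem_sdiff, mem_inter_iff]
    refine ⟨fun hx => ⟨⟨hx.1, ?_⟩, hx.2⟩, fun hx => ⟨hx.1.1, hx.2⟩⟩
    by_contra hB
    exact hx.2 ((heq.symm.subset ⟨hx.1, hB⟩).1)
  have hsub : (E ∩ B) ∩ F = (F ∩ B) ∩ E := by
    rw [inter_right_comm, inter_comm E F, inter_right_comm]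
  rw [← measure_inter_add_sdiff (E ∩ B) hF.measurableSet,
    ← measure_inter_add_sdiff (F ∩ B) hE.measurableSet, ← hsub] at hle
  rw [hEF]
  refine ((ENNReal.add_le_add_iff_left ?_).1 hle).trans
    (measure_mono (sdiff_subset_sdiff_left inter_subset_left))
  exact ((measure_mono inter_subset_left).trans_lt hEfin).ne

end minimality

theorem MeasureTheory.Measure.euclideanHausdorffMeasure_le_iff {X : Type*} [MetricSpace X]
    [MeasurableSpace X] [BorelSpace X] {m : ℕ} {s t : Set X} :
    μHE[m] s ≤ μHE[m] t ↔ μH[m] s ≤ μH[m] t := by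
  rw [Measure.euclideanHausdorffMeasure_def, Measure.smul_apply, Measure.smul_apply,
    ENNReal.smul_def, ENNReal.smul_def, smul_eq_mul, smul_eq_mul,
    ENNReal.mul_le_mul_iff_right
      (by simpa using Measure.addHaarScalarFactor_volume_hausdorffMeasure_ne_zero m) (by simp)]

theorem MeasureTheory.Measure.euclideanHausdorffMeasure_lt_top_iff {X : Type*} [MetricSpace X]
    [MeasurableSpace X] [BorelSpace X] {m : ℕ} {s : Set X} :
    μHE[m] s < ⊤ ↔ μH[m] s < ⊤ := by
  rw [Measure.euclideanHausdorffMeasure_def, Measure.smul_apply, ENNReal.smul_def, smul_eq_mul,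
    ENNReal.mul_lt_top_iff]
  have := Measure.addHaarScalarFactor_volume_hausdorffMeasure_ne_zero m
  simp [this]
  intro h; simp [h]

/-- A deformation in the whole space is Lipschitz at time one, moves points only inside some ball
and maps this ball to itself. -/
theorem IsDeformation.exists_radius {n : ℕ} {φ : ℝ → Euc n → Euc n} (h : IsDeformation univ φ) :
    ∃ (L : ℝ≥0) (R : ℝ), LipschitzWith L (φ 1) ∧ 0 < R ∧ (∀ x, R ≤ ‖x‖ → φ 1 x = x) ∧
      ∀ x, ‖x‖ ≤ R → ‖φ 1 x‖ ≤ R := by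
  obtain ⟨-, -, -, ⟨L, hL⟩, -, hK⟩ := h
  rw [closure_univ, lipschitzOnWith_univ] at hL
  obtain ⟨R, hR0, hR⟩ := hK.isBounded.subset_ball_lt 0 0
  have hmem : ∀ x, φ 1 x ≠ x → ‖x‖ < R ∧ ‖φ 1 x‖ < R := fun x hx => by
    have hx' : x ∈ {x ∈ closure (univ : Set (Euc n)) | φ 1 x ≠ x} := ⟨by simp, hx⟩
    constructor
    · simpa using hR (subset_closure (mem_biUnion (right_mem_Icc.2 zero_le_one) (Or.inl hx')))
    · simpa using hR (subset_closure (mem_biUnion (right_mem_Icc.2 zero_le_one)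
        (Or.inr (mem_image_of_mem _ hx'))))
  refine ⟨L, R, hL, hR0, fun x hx => ?_, fun x hx => ?_⟩
  · by_contra hne
    exact (hmem x hne).1.not_ge hx
  · by_cases hne : φ 1 x = x
    · rwa [hne]
    · exact (hmem x hne).2.le

end

noncomputable section

/-- For every integer d ≥ 3 and every regular d-simplex centered at the origin
of ℝ^d (given by vertices v₀,…,v_d with Σ vᵢ = 0 and |vᵢ − vⱼ| = c > 0 for i ≠ j), the cone
over the (d−2)-skeleton of the simplex is an Almgren minimal set of dimension d−1 in ℝ^d. -/
theorem cone_over_simplex_skeleton_almgren_minimal (d : ℕ) (hd : 3 ≤ d)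
    (v : Fin (d+1) → EuclideanSpace ℝ (Fin d))
    (hcenter : ∑ i, v i = 0)
    (c : ℝ) (hc : 0 < c) (hreg : ∀ i j, i ≠ j → ‖v i - v j‖ = c) :
    AlmgrenMinimal ((d - 1 : ℕ) : ℝ) (Set.univ) (coneOver (simplexSkeleton d v)) := by
  obtain ⟨m, rfl⟩ : ∃ m, d = m + 1 := ⟨d - 1, by omega⟩
  have h : IsCenteredSimplex c v := ⟨hc, hcenter, hreg⟩
  rw [h.coneOver_simplexSkeleton (by omega), Nat.add_sub_cancel]
  change AlmgrenMinimal m univ (minWalls v)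
  refine ⟨isClosed_minWalls, by simp, fun x r _ => ?_, fun φ hφ => ?_⟩
  · exact Measure.euclideanHausdorffMeasure_lt_top_iff.1
      (h.euclideanHausdorffMeasure_minWalls_inter_lt_top isBounded_closedBall)
  · obtain ⟨L, R, hL, hR, hout, hin⟩ := hφ.exists_radius
    exact Measure.euclideanHausdorffMeasure_le_iff.1
      (h.euclideanHausdorffMeasure_minWalls_sdiff_le hL hR hout hin)

end
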